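/- Suppose the third-order ODE u‴ = f(x,u,u′,u″), with f smooth and I₃ ≠ 0, is equivalent to ū‴ = ā(x̄)³·ū (ā smooth and nowhere vanishing) under a contact transformation (x̄,ū,p̄) = (φ(x,u,p), ψ(x,u,p), χ(x,u,p)) with contact multiplier λ. Then, setting H := (ā′/ā²)∘φ, b := ā∘φ, a₁ := λ, η := D̂ₓχ/D̂ₓφ and f̄ := (ā∘φ)³·ψ, the following hold: (i) the Riccati equation −(2/J₃)D̂ₓH + H² = K; (ii) D̂ₓb = −(J₃H)b; (iii) D̂ₓa₁ = J₃(H+I₅)a₁, (a₁)_u = (HI₇ − Q)a₁, (a₁)_p = (I₄(H+I₅) − I₇/J₃)a₁, (a₁)_q = 0; (iv) D̂ₓφ = −J₃/b, φ_u = −I₇/b, φ_p = −I₄/b; (v) D̂ₓη = −(J₃/b)f̄, η_u = ((H+I₅)²/2 + I₂/(2J₃²))b²a₁ − (I₇/b)f̄, η_p = ((H+I₅)/J₃ + I₁/(3J₃²))b²a₁ − (I₄/b)f̄, η_q = b²a₁/J₃²; D̂ₓχ = −(J₃/b)η, χ_u = −(H+I₅)b·a₁ − (I₇/b)η, χ_p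 = −b·a₁/J₃ − (I₄/b)η; I₇D̂ₓψ = J₃(ψ_u − a₁), ψ_x = χφ_x − p·a₁, ψ_p = −(I₄/b)χ. -/

import Mathlib

/-!
Invariants of the third-order ODE `u''' = f(x, u, u', u'')` under contact
transformations, following Cartan's equivalence method.
We write `p = u'`, `q = u''`.
-/

noncomputable section

/-- The real cube root of a real number. -/
def cbrt (y : ℝ) : ℝ := if 0 ≤ y then y ^ ((1 : ℝ)/3) else -((-y) ^ ((1 : ℝ)/3))

/-- Functions of `(x, u, p, q)`. -/
abbrev Fn : Type := ℝ → ℝ → ℝ → ℝ → ℝ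

/-- Functions of `(x, u, p)`. -/
abbrev Fn3 : Type := ℝ → ℝ → ℝ → ℝ

/-- Partial derivative in `x` of a function of `(x,u,p,q)`. -/
def pdx (g : Fn) : Fn := fun x u p q => deriv (fun t => g t u p q) x
/-- Partial derivative in `u` of a function of `(x,u,p,q)`. -/
def pdu (g : Fn) : Fn := fun x u p q => deriv (fun t => g x t p q) u
/-- Partial derivative in `p` of a function of `(x,u,p,q)`. -/
def pdp (g : Fn) : Fn := fun x u p q => deriv (fun t => g x u t q) p
/-- Partial derivative in `q` of a function of `(x,u,p,q)`. -/
def pdq (g : Fn) : Fn := fun x u p q => deriv (fun t => g x u p t) q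

/-- Partial derivative in `x` of a function of `(x,u,p)`. -/
def pdx3 (g : Fn3) : Fn3 := fun x u p => deriv (fun t => g t u p) x
/-- Partial derivative in `u` of a function of `(x,u,p)`. -/
def pdu3 (g : Fn3) : Fn3 := fun x u p => deriv (fun t => g x t p) u
/-- Partial derivative in `p` of a function of `(x,u,p)`. -/
def pdp3 (g : Fn3) : Fn3 := fun x u p => deriv (fun t => g x u t) p

/-- Lift of a function of `(x,u,p)` to a function of `(x,u,p,q)`, constant in `q`. -/
def lift (g : Fn3) : Fn := fun x u p _ => g x u p

/-- The total derivative operator `D̂ₓ = ∂ₓ + p ∂ᵤ + q ∂ₚ + f ∂_q` of the ODE `u''' = f`. -/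
def Dhat (f g : Fn) : Fn := fun x u p q =>
  pdx g x u p q + p * pdu g x u p q + q * pdp g x u p q + f x u p q * pdq g x u p q

/-- `I₁ = −f_q`. -/
def I1 (f : Fn) : Fn := fun x u p q => -(pdq f x u p q)

/-- `I₂ = −(2/9)I₁² − f_p − (1/3)D̂ₓI₁`. -/
def I2 (f : Fn) : Fn := fun x u p q =>
  -(2/9) * (I1 f x u p q)^2 - pdp f x u p q - (1/3) * Dhat f (I1 f) x u p q

/-- `I₃ = −(1/3)I₁I₂ − f_u − (1/2)D̂ₓI₂`. -/
def I3 (f : Fn) : Fn := fun x u p q =>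
  -(1/3) * I1 f x u p q * I2 f x u p q - pdu f x u p q - (1/2) * Dhat f (I2 f) x u p q

/-- `J₃`, the real cube root of `I₃`. -/
def J3 (f : Fn) : Fn := fun x u p q => cbrt (I3 f x u p q)

/-- `I₄ = (J₃)_q`. -/
def I4 (f : Fn) : Fn := pdq (J3 f)

/-- `I₅ = (1/(3J₃²))(I₁J₃ + 3D̂ₓJ₃)`. -/
def I5 (f : Fn) : Fn := fun x u p q =>
  (1 / (3 * (J3 f x u p q)^2)) * (I1 f x u p q * J3 f x u p q + 3 * Dhat f (J3 f) x u p q)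

/-- `I₇ = −(I₅)_q J₃²`. -/
def I7 (f : Fn) : Fn := fun x u p q => -(pdq (I5 f) x u p q) * (J3 f x u p q)^2

/-- `I₉ = 2J₃D̂ₓI₅ − I₂ + J₃²I₅²`. -/
def I9 (f : Fn) : Fn := fun x u p q =>
  2 * J3 f x u p q * Dhat f (I5 f) x u p q - I2 f x u p q
    + (J3 f x u p q)^2 * (I5 f x u p q)^2

/-- `K = I₉/J₃²`. -/
def Kinv (f : Fn) : Fn := fun x u p q => I9 f x u p q / (J3 f x u p q)^2

/-- `Q = −(I₁I₇ + 3J₃²(I₅)_p + 3(J₃)_u − 3J₃I₄D̂ₓI₅)/(3J₃)`. -/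
def Qinv (f : Fn) : Fn := fun x u p q =>
  -(I1 f x u p q * I7 f x u p q + 3 * (J3 f x u p q)^2 * pdp (I5 f) x u p q
      + 3 * pdu (J3 f) x u p q
      - 3 * J3 f x u p q * I4 f x u p q * Dhat f (I5 f) x u p q)
    / (3 * J3 f x u p q)

/-- `I₆ = (2/3)(J₃)_q I₁ − (1/3)(I₁)_q J₃ − 2(J₃)_p + 2J₃I₄I₅`. -/
def I6 (f : Fn) : Fn := fun x u p q =>
  (2/3) * pdq (J3 f) x u p q * I1 f x u p q - (1/3) * pdq (I1 f) x u p q * J3 f x u p q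
    - 2 * pdp (J3 f) x u p q + 2 * J3 f x u p q * I4 f x u p q * I5 f x u p q

/-- `I₈ = (I₄)_q`. -/
def I8 (f : Fn) : Fn := pdq (I4 f)

/-- `I₁₀ = I₄D̂ₓI₇ − J₃(I₇)_p + J₃²(I₄/J₃)_u`. -/
def I10 (f : Fn) : Fn := fun x u p q =>
  I4 f x u p q * Dhat f (I7 f) x u p q - J3 f x u p q * pdp (I7 f) x u p q
    + (J3 f x u p q)^2 *
      pdu (fun x' u' p' q' => I4 f x' u' p' q' / J3 f x' u' p' q') x u p q

/-- `I₁₁ = (J₃)_u − D̂ₓI₇`. -/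
def I11 (f : Fn) : Fn := fun x u p q =>
  pdu (J3 f) x u p q - Dhat f (I7 f) x u p q

/-- `I₁₂`. -/
def I12 (f : Fn) : Fn := fun x u p q =>
  6 * I1 f x u p q * J3 f x u p q *
      (I5 f x u p q * I7 f x u p q - I4 f x u p q * Dhat f (I5 f) x u p q)
    - 18 * (J3 f x u p q)^3 * I4 f x u p q
    + 6 * pdp (I5 f) x u p q * I1 f x u p q * (J3 f x u p q)^2
    - 18 * I2 f x u p q * J3 f x u p q * I4 f x u p q * I5 f x u p q
    - 18 * J3 f x u p q * I7 f x u p q * Dhat f (I5 f) x u p q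
    + 18 * (J3 f x u p q)^2 * pdu (I5 f) x u p q
    + 18 * I2 f x u p q * Dhat f (I4 f) x u p q
    + 2 * (I1 f x u p q)^2 * I7 f x u p q
    - 9 * pdp (I2 f) x u p q * J3 f x u p q
    + 6 * (J3 f x u p q)^2 *
        pdu (fun x' u' p' q' => I1 f x' u' p' q' / J3 f x' u' p' q') x u p q
    + 36 * I2 f x u p q * I7 f x u p q

/-- `I₁₃ = (J₃I₄I₅ − I₇)D̂ₓK + J₃K_u − J₃²I₅K_p`. -/
def I13 (f : Fn) : Fn := fun x u p q =>
  (J3 f x u p q * I4 f x u p q * I5 f x u p q - I7 f x u p q) * Dhat f (Kinv f) x u p q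
    + J3 f x u p q * pdu (Kinv f) x u p q
    - (J3 f x u p q)^2 * I5 f x u p q * pdp (Kinv f) x u p q

/-- `I₁₄ = K_q`. -/
def I14 (f : Fn) : Fn := pdq (Kinv f)

/-- `I₁₅ = I₄D̂ₓK − J₃K_p`. -/
def I15 (f : Fn) : Fn := fun x u p q =>
  I4 f x u p q * Dhat f (Kinv f) x u p q - J3 f x u p q * pdp (Kinv f) x u p q

/-- The Jacobian determinant of the map `(x,u,p) ↦ (φ, ψ, χ)`. -/
def jac3 (φ ψ χ : Fn3) : Fn3 := fun x u p =>
  Matrix.det !![pdx3 φ x u p, pdu3 φ x u p, pdp3 φ x u p;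
                pdx3 ψ x u p, pdu3 ψ x u p, pdp3 ψ x u p;
                pdx3 χ x u p, pdu3 χ x u p, pdp3 χ x u p]

/-- A contact transformation `(x̄,ū,p̄) = (φ(x,u,p), ψ(x,u,p), χ(x,u,p))` on an open set
`U ⊆ ℝ³`: a smooth map with nowhere-vanishing Jacobian determinant, together with a
nowhere-vanishing contact multiplier `lam` such that `dψ − χ dφ = lam (du − p dx)`. -/
structure IsContactTransformOn (U : Set (ℝ × ℝ × ℝ)) (φ ψ χ lam : Fn3) : Prop where
  isOpen : IsOpen U
  smooth : ContDiffOn ℝ (⊤ : ℕ∞) (fun v : ℝ × ℝ × ℝ =>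
      (φ v.1 v.2.1 v.2.2, ψ v.1 v.2.1 v.2.2, χ v.1 v.2.1 v.2.2)) U
  jac_ne : ∀ x u p, (x, u, p) ∈ U → jac3 φ ψ χ x u p ≠ 0
  lam_ne : ∀ x u p, (x, u, p) ∈ U → lam x u p ≠ 0
  contact_p : ∀ x u p, (x, u, p) ∈ U → pdp3 ψ x u p - χ x u p * pdp3 φ x u p = 0
  contact_u : ∀ x u p, (x, u, p) ∈ U → pdu3 ψ x u p - χ x u p * pdu3 φ x u p = lam x u p
  contact_x : ∀ x u p, (x, u, p) ∈ U → pdx3 ψ x u p - χ x u p * pdx3 φ x u p = -p * lam x u p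

/-- `u` is a smooth solution of the third-order ODE `u''' = f(x,u,u',u'')` on `I`. -/
def SolvesODE3 (f : Fn) (I : Set ℝ) (u : ℝ → ℝ) : Prop :=
  ContDiffOn ℝ (⊤ : ℕ∞) u I ∧
  ∀ x ∈ I, deriv (deriv (deriv u)) x = f x (u x) (deriv u x) (deriv (deriv u) x)

/-- The ODE `u''' = f(x,u,u',u'')` is equivalent to `ū''' = f̄(x̄,ū,ū',ū'')` under the
contact transformation `(φ, ψ, χ)` on `U`: for every smooth solution `u` of the first
equation, defined on an open interval, whose prolonged graph `(x, u(x), u'(x))` lies in `U`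
and for which `x̄(x) := φ(x,u(x),u'(x))` has nonvanishing derivative, the function `v` of
`x̄` defined by `v(x̄(x)) = ψ(x,u(x),u'(x))` is a smooth solution of the second equation
and satisfies `dv/dx̄ = χ(x,u(x),u'(x))`. -/
def ContactEquivOn (f fbar : Fn) (U : Set (ℝ × ℝ × ℝ)) (φ ψ χ : Fn3) : Prop :=
  ∀ (I : Set ℝ) (u : ℝ → ℝ), IsOpen I → I.OrdConnected →
    SolvesODE3 f I u →
    (∀ x ∈ I, (x, u x, deriv u x) ∈ U) →
    (∀ x ∈ I, deriv (fun t => φ t (u t) (deriv u t)) x ≠ 0) →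
    ∃ v : ℝ → ℝ,
      ContDiffOn ℝ (⊤ : ℕ∞) v ((fun t => φ t (u t) (deriv u t)) '' I) ∧
      (∀ x ∈ I, v (φ x (u x) (deriv u x)) = ψ x (u x) (deriv u x)) ∧
      (∀ x ∈ I, deriv v (φ x (u x) (deriv u x)) = χ x (u x) (deriv u x)) ∧
      (∀ y ∈ (fun t => φ t (u t) (deriv u t)) '' I,
        deriv (deriv (deriv v)) y = fbar y (v y) (deriv v y) (deriv (deriv v) y))

/-- Four commuting derivations of a commutative ring together with two elements on which they act
as the coordinate derivations `∂ₓ, ∂ᵤ, ∂ₚ, ∂_q` act on the coordinates `p` and `q`. -/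
structure IsJetRing {A : Type*} [CommRing A] [Algebra ℝ A] (dx du dp dq : Derivation ℝ A A)
    (p q : A) : Prop where
  dx_du : ∀ a, dx (du a) = du (dx a)
  dx_dp : ∀ a, dx (dp a) = dp (dx a)
  dx_dq : ∀ a, dx (dq a) = dq (dx a)
  du_dp : ∀ a, du (dp a) = dp (du a)
  du_dq : ∀ a, du (dq a) = dq (du a)
  dp_dq : ∀ a, dp (dq a) = dq (dp a)
  dx_p : dx p = 0
  du_p : du p = 0
  dp_p : dp p = 1
  dq_p : dq p = 0
  dx_q : dx q = 0
  du_q : du q = 0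
  dp_q : dp q = 0
  dq_q : dq q = 1

namespace IsJetRing

variable {A : Type*} [CommRing A] [Algebra ℝ A] {dx du dp dq : Derivation ℝ A A} {p q : A}

/-- The total derivative `∂ₓ + p ∂ᵤ + q ∂ₚ + f ∂_q`. -/
def total (dx du dp dq : Derivation ℝ A A) (p q f : A) : Derivation ℝ A A :=
  dx + p • du + q • dp + f • dq

theorem total_apply (f a : A) :
    total dx du dp dq p q f a = dx a + p * du a + q * dp a + f * dq a := by
  simp [total]

theorem dq_total (h : IsJetRing dx du dp dq p q) (f a : A) :
    dq (total dx du dp dq p q f a)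
      = total dx du dp dq p q f (dq a) + dp a + dq f * dq a := by
  simp only [total_apply, map_add, Derivation.leibniz, smul_eq_mul, h.dx_dq, h.du_dq, h.dp_dq,
    h.dq_p, h.dq_q]
  ring

theorem dp_total (h : IsJetRing dx du dp dq p q) (f a : A) :
    dp (total dx du dp dq p q f a)
      = total dx du dp dq p q f (dp a) + du a + dp f * dq a := by
  simp only [total_apply, map_add, Derivation.leibniz, smul_eq_mul, h.dx_dp, h.du_dp, h.dp_dq,
    h.dp_p, h.dp_q]
  ring

theorem du_total (h : IsJetRing dx du dp dq p q) (f a : A) :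
    du (total dx du dp dq p q f a)
      = total dx du dp dq p q f (du a) + du f * dq a := by
  simp only [total_apply, map_add, Derivation.leibniz, smul_eq_mul, h.dx_du, h.du_dp, h.du_dq,
    h.du_p, h.du_q]
  ring

/-- The data of a contact transformation, written in a jet ring. -/
structure IsContact (dx du dp dq : Derivation ℝ A A) (p φ ψ χ lam : A) : Prop where
  dq_φ : dq φ = 0
  dq_ψ : dq ψ = 0
  dq_χ : dq χ = 0
  dq_lam : dq lam = 0
  dp_ψ : dp ψ = χ * dp φ
  du_ψ : du ψ = χ * du φ + lam
  dx_ψ : dx ψ = χ * dx φ - p * lam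

variable {φ ψ χ lam : A}

theorem dp_lam (h : IsJetRing dx du dp dq p q) (hc : IsContact dx du dp dq p φ ψ χ lam) :
    dp lam = du χ * dp φ - dp χ * du φ := by
  have e1 := congrArg du hc.dp_ψ
  have e2 := congrArg dp hc.du_ψ
  simp only [map_add, Derivation.leibniz, smul_eq_mul, h.du_dp] at e1 e2
  linear_combination e1 - e2

theorem lam_eq (h : IsJetRing dx du dp dq p q) (hc : IsContact dx du dp dq p φ ψ χ lam) (f : A) :
    lam = dp χ * total dx du dp dq p q f φ - dp φ * total dx du dp dq p q f χ := by
  have e1 := congrArg dx hc.dp_ψ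
  have e2 := congrArg dp hc.dx_ψ
  have e3 := h.dp_lam hc
  simp only [map_sub, Derivation.leibniz, smul_eq_mul, h.dx_dp, h.dp_p] at e1 e2
  simp only [total_apply, hc.dq_φ, hc.dq_χ]
  linear_combination e2 - e1 - p * e3

theorem total_lam (h : IsJetRing dx du dp dq p q) (hc : IsContact dx du dp dq p φ ψ χ lam)
    (f : A) :
    total dx du dp dq p q f lam
      = du χ * total dx du dp dq p q f φ - du φ * total dx du dp dq p q f χ := by
  have e1 := congrArg dx hc.du_ψ
  have e2 := congrArg du hc.dx_ψ
  have e3 := h.dp_lam hc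
  simp only [map_add, map_sub, Derivation.leibniz, smul_eq_mul, h.dx_du, h.du_p] at e1 e2
  simp only [total_apply, hc.dq_φ, hc.dq_χ, hc.dq_lam]
  linear_combination e2 - e1 + q * e3

theorem isUnit_ofNat (n : ℕ) [n.AtLeastTwo] : IsUnit (OfNat.ofNat n : A) := by
  have : IsUnit (OfNat.ofNat n : ℝ) := IsUnit.mk0 _ (OfNat.ofNat_ne_zero n)
  have h := this.map (algebraMap ℝ A)
  rwa [map_ofNat] at h

/-- The consequences of the transformed equation `D̂ₓ η = F D̂ₓ φ` which do not involve the
invariants of order zero: here `t` is the logarithmic derivative of the contact multiplier. -/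
theorem contact_system (h : IsJetRing dx du dp dq p q) (hc : IsContact dx du dp dq p φ ψ χ lam)
    {f s η F b b1 t I₁ I₂ I₃ : A}
    (hs : s = total dx du dp dq p q f φ) (hη : η * s = total dx du dp dq p q f χ)
    (hF : F = b ^ 3 * ψ) (hode : total dx du dp dq p q f η = F * s)
    (hbu : du b = b1 * du φ) (hbp : dp b = b1 * dp φ) (hbq : dq b = 0)
    (hbt : total dx du dp dq p q f b = b1 * s)
    (ht : 3 * s * t = 3 * total dx du dp dq p q f s + I₁ * s)
    (hI₁ : I₁ = -dq f)
    (hI₂ : 9 * I₂ = -2 * I₁ ^ 2 - 9 * dp f - 3 * total dx du dp dq p q f I₁)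
    (hI₃ : 6 * I₃ = -2 * I₁ * I₂ - 6 * du f - 3 * total dx du dp dq p q f I₂)
    (us : IsUnit s) (ulam : IsUnit lam) :
    (b * s) ^ 3 = -I₃ ∧
    total dx du dp dq p q f lam = lam * t ∧
    s * dp lam = lam * (t * dp φ - du φ) ∧
    6 * total dx du dp dq p q f t = 3 * t ^ 2 - 2 * I₁ * t + 3 * I₂ ∧
    s ^ 2 * dq η = lam ∧
    3 * (dp η - F * dp φ) = dq η * (3 * t + I₁) ∧
    2 * (du η - F * du φ) = dq η * (t ^ 2 + I₂) ∧
    dp χ - η * dp φ = s * dq η ∧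
    du χ - η * du φ = s * dq η * t := by
  have hTq := h.dq_total f
  have hTp := h.dp_total f
  have hTu := h.du_total f
  have hdl := h.dp_lam hc
  have hl := h.lam_eq hc f
  have hTl := h.total_lam hc f
  set T := total dx du dp dq p q f with hT
  have hqs : dq s = dp φ := by
    rw [hs, hTq, hc.dq_φ]; simp
  have hps : dp s = T (dp φ) + du φ := by
    rw [hs, hTp, hc.dq_φ]; simp
  have hus : du s = T (du φ) := by
    rw [hs, hTu, hc.dq_φ]; simp
  have hχp : dp χ = s * dq η + η * dp φ := by
    have e := congrArg dq hη
    rw [hTq, hc.dq_χ] at e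
    simp only [Derivation.leibniz, smul_eq_mul, hqs, map_zero, mul_zero, add_zero, zero_add] at e
    linear_combination -e
  have hlC : lam = s ^ 2 * dq η := by
    linear_combination hl + dp χ * -hs + dp φ * hη + s * hχp
  have uC : IsUnit (dq η) := isUnit_of_mul_isUnit_right (hlC ▸ ulam)
  have hTl : T lam = s * (du χ - η * du φ) := by
    linear_combination hTl - du χ * hs + du φ * hη
  have hTψ : T ψ = χ * s := by
    rw [hs, hT, total_apply, total_apply, hc.dx_ψ, hc.du_ψ, hc.dp_ψ, hc.dq_φ, hc.dq_ψ]
    ring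
  have hFq : dq F = 0 := by
    rw [hF]; simp [Derivation.leibniz, Derivation.leibniz_pow, hbq, hc.dq_ψ]
  have hFp : dp F * s = T F * dp φ := by
    rw [hF]
    simp only [Derivation.leibniz, Derivation.leibniz_pow, smul_eq_mul, nsmul_eq_mul, hbp, hbt,
      hTψ, hc.dp_ψ]
    ring
  have hFu : du F * s = T F * du φ + b ^ 3 * lam * s := by
    rw [hF]
    simp only [Derivation.leibniz, Derivation.leibniz_pow, smul_eq_mul, nsmul_eq_mul, hbu, hbt,
      hTψ, hc.du_ψ]
    ring
  clear_value T
  set C := dq η with hC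
  obtain ⟨B₁, hB₁⟩ : ∃ a, a = dp η - F * dp φ := ⟨_, rfl⟩
  obtain ⟨B₂, hB₂⟩ : ∃ a, a = du η - F * du φ := ⟨_, rfl⟩
  obtain ⟨d, hd⟩ : ∃ a, a = du χ - η * du φ := ⟨_, rfl⟩
  -- the structure equations obtained by commuting `D̂ₓ` with the partial derivatives
  have hTsC : T (s * C) + d = s * B₁ := by
    have e := congrArg dp hη
    have e' := congrArg T hχp
    rw [hTp, hc.dq_χ] at e
    rw [map_add, T.leibniz η, hode] at e'
    simp only [dp.leibniz, smul_eq_mul, hps] at e e'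
    linear_combination -e - e' + hd - s * hB₁
  have hTd : T d = s * B₂ := by
    have e := congrArg du hη
    have e' := congrArg T hd
    rw [hTu, hc.dq_χ] at e
    rw [map_sub] at e'
    simp only [Derivation.leibniz, smul_eq_mul, hus, hode] at e e'
    linear_combination e' - e - s * hB₂
  have hTC : T C + B₁ = I₁ * C := by
    have e := congrArg dq hode
    rw [hTq] at e
    simp only [Derivation.leibniz, smul_eq_mul, hqs, hFq] at e
    linear_combination e + hB₁ - hI₁ * C
  have hTB₁ : T B₁ + B₂ + dp f * C = 0 := by
    have e := congrArg dp hode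
    have e' := congrArg T hB₁
    rw [hTp] at e
    rw [map_sub] at e'
    simp only [Derivation.leibniz, smul_eq_mul, hps] at e e'
    linear_combination e + e' + hB₂ + hFp
  have hTB₂ : T B₂ + du f * C = b ^ 3 * lam * s := by
    have e := congrArg du hode
    have e' := congrArg T hB₂
    rw [hTu] at e
    rw [map_sub] at e'
    simp only [Derivation.leibniz, smul_eq_mul, hus] at e e'
    linear_combination e + e' + hFu
  rw [← hd] at hTl ⊢
  rw [← hB₁, ← hB₂]
  have u3 : IsUnit (3 : A) := isUnit_ofNat 3
  have u2 : IsUnit (2 : A) := isUnit_ofNat 2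
  have hd' : d = s * C * t := by
    have e := congrArg T hlC
    have e' := hTsC
    simp only [Derivation.leibniz, Derivation.leibniz_pow, smul_eq_mul, nsmul_eq_mul] at e e'
    have e1 : d = 2 * C * T s + s * T C := us.mul_left_cancel (by
      linear_combination e - hTl)
    exact u3.mul_left_cancel (by linear_combination 2 * e1 + e' + s * hTC - C * ht)
  have hB₁' : 3 * B₁ = C * (3 * t + I₁) := by
    have e := hTsC
    have e2 := congrArg T hlC
    simp only [Derivation.leibniz, Derivation.leibniz_pow, smul_eq_mul, nsmul_eq_mul] at e e2
    refine us.mul_left_cancel ?_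
    have e1 : d = 2 * C * T s + s * T C := us.mul_left_cancel (by
      linear_combination e2 - hTl)
    linear_combination -3 * e - 3 * e1 + 6 * hd' + C * ht
  have hTC' : 3 * T C = C * (2 * I₁ - 3 * t) := by
    linear_combination 3 * hTC - hB₁'
  have hB₂' : 3 * B₂ = C * (I₁ * t + 3 * T t) := by
    refine us.mul_left_cancel ?_
    have e := congrArg T hd'
    rw [Derivation.leibniz, smul_eq_mul, smul_eq_mul] at e
    linear_combination 3 * e - 3 * hTd + 3 * t * hTsC - 3 * t * hd' + s * t * hB₁'
  have h3 (D : Derivation ℝ A A) (n : ℕ) [n.AtLeastTwo] : D (OfNat.ofNat n : A) = 0 :=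
    D.map_natCast n
  have hTt : 6 * T t = 3 * t ^ 2 - 2 * I₁ * t + 3 * I₂ := by
    have e := congrArg T hB₁'
    simp only [Derivation.leibniz, smul_eq_mul, map_add, h3] at e
    refine u3.mul_left_cancel (uC.mul_left_cancel ?_)
    linear_combination -3 * e + 9 * hTB₁ - 3 * hB₂' - C * hI₂ - (3 * t + I₁) * hTC'
  have hB₂'' : 2 * B₂ = C * (t ^ 2 + I₂) := by
    refine u3.mul_left_cancel ?_
    linear_combination 2 * hB₂' + C * hTt
  refine ⟨?_, ?_, ?_, hTt, hlC.symm, hB₁', hB₂'', ?_, hd'⟩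
  · have e := congrArg T hB₂''
    simp only [Derivation.leibniz, Derivation.leibniz_pow, smul_eq_mul, nsmul_eq_mul, map_add, h3]
      at e
    refine u3.mul_left_cancel (u2.mul_left_cancel (uC.mul_left_cancel ?_))
    linear_combination -6 * hTB₂ + 3 * e - 6 * b ^ 3 * s * hlC + C * hI₃ + (t ^ 2 + I₂) * hTC'
      + C * t * hTt
  · linear_combination hTl + s * hd' - t * hlC
  · linear_combination s * hdl - s * dp φ * hd - s * du φ * hχp + s * dp φ * hd'
      - (t * dp φ - du φ) * hlC
  · linear_combination hχp

/-- The invariants `J₃, I₄, I₅, I₇, Q` in terms of the contact transformation and the logarithmic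
derivative `t` of its multiplier. -/
theorem contact_invariants (h : IsJetRing dx du dp dq p q)
    (hc : IsContact dx du dp dq p φ ψ χ lam)
    {f s b H b1 h1 t J I₁ I₂ I₄ I₅ I₇ Q : A}
    (hs : s = total dx du dp dq p q f φ)
    (hb1 : b1 = H * b ^ 2)
    (hbu : du b = b1 * du φ) (hbp : dp b = b1 * dp φ) (hbq : dq b = 0)
    (hbt : total dx du dp dq p q f b = b1 * s)
    (hHp : dp H = h1 * dp φ) (hHq : dq H = 0)
    (hHt : total dx du dp dq p q f H = h1 * s)
    (ht : 3 * s * t = 3 * total dx du dp dq p q f s + I₁ * s)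
    (hJ : J = -(b * s)) (hI₄ : I₄ = dq J)
    (hI₅ : 3 * J ^ 2 * I₅ = I₁ * J + 3 * total dx du dp dq p q f J)
    (hI₇ : I₇ = -dq I₅ * J ^ 2)
    (hQ : 3 * J * Q = -(I₁ * I₇ + 3 * J ^ 2 * dp I₅ + 3 * du J
      - 3 * J * I₄ * total dx du dp dq p q f I₅))
    (us : IsUnit s) (ub : IsUnit b) (ulam : IsUnit lam)
    (hlt : total dx du dp dq p q f lam = lam * t)
    (hlp : s * dp lam = lam * (t * dp φ - du φ))
    (htt : 6 * total dx du dp dq p q f t = 3 * t ^ 2 - 2 * I₁ * t + 3 * I₂) :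
    t = J * (H + I₅) ∧ I₄ = -(b * dp φ) ∧ I₇ = -(b * du φ) ∧
    du lam = (H * I₇ - Q) * lam ∧
    -2 * J * total dx du dp dq p q f H + J ^ 2 * H ^ 2
      = 2 * J * total dx du dp dq p q f I₅ - I₂ + J ^ 2 * I₅ ^ 2 := by
  have hTq := h.dq_total f
  have hTp := h.dp_total f
  have hTu := h.du_total f
  set T := total dx du dp dq p q f with hT
  have hqs : dq s = dp φ := by
    rw [hs, hTq, hc.dq_φ]; simp
  have hps : dp s = T (dp φ) + du φ := by
    rw [hs, hTp, hc.dq_φ]; simp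
  have hus : du s = T (du φ) := by
    rw [hs, hTu, hc.dq_φ]; simp
  clear_value T
  have u3 : IsUnit (3 : A) := isUnit_ofNat 3
  have hTJ : T J = -(b * T s + s * (b1 * s)) := by
    rw [hJ]; simp only [map_neg, Derivation.leibniz, smul_eq_mul, hbt]
  have hJu : du J = -(b * T (du φ) + s * (b1 * du φ)) := by
    rw [hJ]; simp only [map_neg, Derivation.leibniz, smul_eq_mul, hbu, hus]
  have hJp : dp J = -(b * (T (dp φ) + du φ) + s * (b1 * dp φ)) := by
    rw [hJ]; simp only [map_neg, Derivation.leibniz, smul_eq_mul, hbp, hps]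
  have hJq : dq J = -(b * dp φ) := by
    rw [hJ]; simp only [map_neg, Derivation.leibniz, smul_eq_mul, hbq, hqs]; ring
  have uJ : IsUnit J := by rw [hJ]; exact (ub.mul us).neg
  have htJ : t = J * (H + I₅) := by
    refine u3.mul_left_cancel (uJ.mul_left_cancel ?_)
    linear_combination -hI₅ - 3 * hTJ + 3 * s ^ 2 * hb1 - b * ht
      + (3 * t - I₁ - 3 * H * (J - s * b)) * hJ
  have hI₇' : I₇ = -(b * du φ) := by
    have e := congrArg dq hlt
    rw [hTq, hc.dq_lam, htJ] at e
    simp only [Derivation.leibniz, smul_eq_mul, hHq, hJq, hc.dq_lam, map_zero, map_add] at e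
    refine us.mul_left_cancel (ulam.mul_left_cancel ?_)
    linear_combination lam * s * hI₇ + b * s * hlp - b * s ^ 2 * e - lam * s * J * dq I₅ * hJ
      + b * s * lam * dp φ * htJ + b * s * lam * dp φ * (H + I₅) * hJ
  have hTt : T t = -(b * T s + s * (H * b ^ 2 * s)) * (H + I₅) - b * s * (h1 * s + T I₅) := by
    rw [htJ]
    simp only [Derivation.leibniz, smul_eq_mul, map_add, hTJ, hHt]
    rw [hJ, hb1]
    ring
  have hpt : dp t = -(b * (T (dp φ) + du φ) + s * (H * b ^ 2 * dp φ)) * (H + I₅)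
      - b * s * (h1 * dp φ + dp I₅) := by
    rw [htJ]
    simp only [Derivation.leibniz, smul_eq_mul, map_add, hJp, hHp]
    rw [hJ, hb1]
    ring
  refine ⟨htJ, hI₄.trans hJq, hI₇', ?_, ?_⟩
  · have e := congrArg dp hlt
    have e2 := congrArg T hlp
    rw [hTp, hc.dq_lam] at e
    simp only [Derivation.leibniz, smul_eq_mul, map_sub, hlt, hTt, hpt] at e e2
    rw [hI₄, hJq, hJu, hI₇', hb1, hJ] at hQ
    rw [hJ] at htJ
    rw [htJ] at ht e e2 hlp
    rw [hI₇']
    refine u3.mul_left_cancel ((ub.mul (us.pow 3)).mul_left_cancel ?_)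
    linear_combination 3 * b * s ^ 3 * e - 3 * b * s ^ 2 * e2
      + 3 * b * s * (T s - b * s ^ 2 * (H + I₅)) * hlp - s ^ 2 * lam * hQ
      + b * s * lam * du φ * ht
  · rw [htJ] at htt
    simp only [Derivation.leibniz, smul_eq_mul, map_add] at htt
    refine u3.mul_left_cancel ?_
    linear_combination -htt - 2 * (H + I₅) * hI₅
end IsJetRing

open scoped ContDiff

/-- The algebra of smooth functions on a subset `W` of the jet space. -/
def smoothFunctions (W : Set (ℝ × ℝ × ℝ × ℝ)) : Subalgebra ℝ (W → ℝ) where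
  carrier := {g | ∃ G : ℝ × ℝ × ℝ × ℝ → ℝ, ContDiffOn ℝ ∞ G W ∧ ∀ w : W, G w = g w}
  mul_mem' := by
    rintro a b ⟨G, hG, hGa⟩ ⟨K, hK, hKb⟩
    exact ⟨fun z => G z * K z, hG.mul hK, fun w => by simp [hGa, hKb]⟩
  add_mem' := by
    rintro a b ⟨G, hG, hGa⟩ ⟨K, hK, hKb⟩
    exact ⟨fun z => G z + K z, hG.add hK, fun w => by simp [hGa, hKb]⟩
  algebraMap_mem' r := ⟨fun _ => r, contDiffOn_const, fun _ => rfl⟩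

namespace smoothFunctions

variable {W : Set (ℝ × ℝ × ℝ × ℝ)}

/-- A smooth function representing an element of `smoothFunctions W`. -/
def extend (g : smoothFunctions W) : ℝ × ℝ × ℝ × ℝ → ℝ := g.2.choose

theorem contDiffOn_extend (g : smoothFunctions W) : ContDiffOn ℝ ∞ (extend g) W :=
  g.2.choose_spec.1

theorem extend_apply (g : smoothFunctions W) (w : W) : (extend g) w = g.1 w :=
  g.2.choose_spec.2 w

theorem fderiv_extend (hW : IsOpen W) (g : smoothFunctions W) {G : ℝ × ℝ × ℝ × ℝ → ℝ}
    (hG : ∀ w : W, G w = g.1 w) (w : W) : fderiv ℝ (extend g) w = fderiv ℝ G w :=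
  Filter.EventuallyEq.fderiv_eq (by
    filter_upwards [hW.mem_nhds w.2] with z hz
    rw [extend_apply g ⟨z, hz⟩, hG ⟨z, hz⟩])

theorem differentiableAt_extend (hW : IsOpen W) (g : smoothFunctions W) (w : W) :
    DifferentiableAt ℝ (extend g) w :=
  ((contDiffOn_extend g).contDiffAt (hW.mem_nhds w.2)).differentiableAt (by simp)

theorem contDiffOn_fderiv_apply (hW : IsOpen W) {G : ℝ × ℝ × ℝ × ℝ → ℝ}
    (hG : ContDiffOn ℝ ∞ G W) (v : ℝ × ℝ × ℝ × ℝ) :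
    ContDiffOn ℝ ∞ (fun z => fderiv ℝ G z v) W :=
  (hG.fderiv_of_isOpen hW (m := ∞) (by simp)).clm_apply contDiffOn_const

/-- The derivative in the direction of `v`, as a derivation of the algebra of smooth functions. -/
def dirDeriv (hW : IsOpen W) (v : ℝ × ℝ × ℝ × ℝ) :
    Derivation ℝ (smoothFunctions W) (smoothFunctions W) :=
  Derivation.mk'
    { toFun := fun g => ⟨fun w => fderiv ℝ (extend g) w v, fun z => fderiv ℝ (extend g) z v,
        contDiffOn_fderiv_apply hW (contDiffOn_extend g) v, fun _ => rfl⟩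
      map_add' := fun a b => by
        ext w
        change fderiv ℝ (extend (a + b)) w v
          = fderiv ℝ (extend a) w v + fderiv ℝ (extend b) w v
        rw [fderiv_extend hW (a + b) (G := (extend a) + (extend b))
            (fun w => by simp [extend_apply]) w,
          fderiv_add (differentiableAt_extend hW a w) (differentiableAt_extend hW b w)]
        rfl
      map_smul' := fun r a => by
        ext w
        change fderiv ℝ (extend (r • a)) w v = r • fderiv ℝ (extend a) w v
        rw [fderiv_extend hW (r • a) (G := r • (extend a)) (fun w => by simp [extend_apply]) w,
          fderiv_const_smul (differentiableAt_extend hW a w)]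
        rfl }
    (fun a b => by
      ext w
      simp only [LinearMap.coe_mk, AddHom.coe_mk, smul_eq_mul]
      rw [fderiv_extend hW (a * b) (G := (extend a) * (extend b))
          (fun w => by simp [extend_apply]) w,
        fderiv_mul (differentiableAt_extend hW a w) (differentiableAt_extend hW b w)]
      simp [extend_apply])

theorem dirDeriv_apply (hW : IsOpen W) (v : ℝ × ℝ × ℝ × ℝ) (g : smoothFunctions W)
    {G : ℝ × ℝ × ℝ × ℝ → ℝ} (hG : ∀ w : W, G w = g.1 w) (w : W) :
    (dirDeriv hW v g).1 w = fderiv ℝ G w v := by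
  rw [← fderiv_extend hW g hG w]
  rfl

theorem dirDeriv_comm (hW : IsOpen W) (v v' : ℝ × ℝ × ℝ × ℝ) (g : smoothFunctions W) :
    dirDeriv hW v (dirDeriv hW v' g) = dirDeriv hW v' (dirDeriv hW v g) := by
  ext w
  have hg : ContDiffAt ℝ ∞ (extend g) w := (contDiffOn_extend g).contDiffAt (hW.mem_nhds w.2)
  have hd : DifferentiableAt ℝ (fderiv ℝ (extend g)) w :=
    (hg.fderiv_right (m := 1) (by norm_cast)).differentiableAt (by simp)
  have key : ∀ v v', (dirDeriv hW v (dirDeriv hW v' g)).1 w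
      = fderiv ℝ (fderiv ℝ (extend g)) w v v' := by
    intro v v'
    rw [dirDeriv_apply hW v _ (G := fun z => fderiv ℝ (extend g) z v') (fun _ => rfl),
      fderiv_clm_apply hd (differentiableAt_const _)]
    simp
  rw [key, key]
  exact hg.isSymmSndFDerivAt (by simp; norm_cast) _ _

end smoothFunctions

/-- Smoothness of a function of `(x,u,p,q)` on a set. -/
def SmoothFnOn (W : Set (ℝ × ℝ × ℝ × ℝ)) (g : Fn) : Prop :=
  ContDiffOn ℝ ∞ (fun z : ℝ × ℝ × ℝ × ℝ => g z.1 z.2.1 z.2.2.1 z.2.2.2) W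

namespace SmoothFnOn

variable {W : Set (ℝ × ℝ × ℝ × ℝ)} {f g h : Fn}

theorem differentiableAt (hW : IsOpen W) (hg : SmoothFnOn W g) {x u p q : ℝ}
    (hz : (x, u, p, q) ∈ W) :
    DifferentiableAt ℝ (fun z : ℝ × ℝ × ℝ × ℝ => g z.1 z.2.1 z.2.2.1 z.2.2.2) (x, u, p, q) :=
  (hg.contDiffAt (hW.mem_nhds hz)).differentiableAt (by simp)

theorem deriv_comp (hW : IsOpen W) (hg : SmoothFnOn W g) {x u p q : ℝ}
    (hz : (x, u, p, q) ∈ W) {γ : ℝ → ℝ × ℝ × ℝ × ℝ} {v : ℝ × ℝ × ℝ × ℝ} {t : ℝ}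
    (hγ : HasDerivAt γ v t) (hγt : γ t = (x, u, p, q)) :
    HasDerivAt (fun t => g (γ t).1 (γ t).2.1 (γ t).2.2.1 (γ t).2.2.2)
      (fderiv ℝ (fun z : ℝ × ℝ × ℝ × ℝ => g z.1 z.2.1 z.2.2.1 z.2.2.2) (x, u, p, q) v) t := by
  have h := (hg.differentiableAt hW hz).hasFDerivAt
  rw [← hγt] at h ⊢
  exact h.comp_hasDerivAt t hγ

theorem pdx_eq (hW : IsOpen W) (hg : SmoothFnOn W g) {x u p q : ℝ} (hz : (x, u, p, q) ∈ W) :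
    pdx g x u p q = fderiv ℝ (fun z : ℝ × ℝ × ℝ × ℝ => g z.1 z.2.1 z.2.2.1 z.2.2.2)
      (x, u, p, q) (1, 0, 0, 0) :=
  (hg.deriv_comp hW hz (t := x) ((hasDerivAt_id x).prodMk (hasDerivAt_const x (u, p, q))) rfl).deriv

theorem pdu_eq (hW : IsOpen W) (hg : SmoothFnOn W g) {x u p q : ℝ} (hz : (x, u, p, q) ∈ W) :
    pdu g x u p q = fderiv ℝ (fun z : ℝ × ℝ × ℝ × ℝ => g z.1 z.2.1 z.2.2.1 z.2.2.2)
      (x, u, p, q) (0, 1, 0, 0) :=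
  (hg.deriv_comp hW hz (t := u) ((hasDerivAt_const u x).prodMk
    ((hasDerivAt_id u).prodMk (hasDerivAt_const u (p, q)))) rfl).deriv

theorem pdp_eq (hW : IsOpen W) (hg : SmoothFnOn W g) {x u p q : ℝ} (hz : (x, u, p, q) ∈ W) :
    pdp g x u p q = fderiv ℝ (fun z : ℝ × ℝ × ℝ × ℝ => g z.1 z.2.1 z.2.2.1 z.2.2.2)
      (x, u, p, q) (0, 0, 1, 0) :=
  (hg.deriv_comp hW hz (t := p) ((hasDerivAt_const p x).prodMk
    ((hasDerivAt_const p u).prodMk ((hasDerivAt_id p).prodMk (hasDerivAt_const p q)))) rfl).deriv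

theorem pdq_eq (hW : IsOpen W) (hg : SmoothFnOn W g) {x u p q : ℝ} (hz : (x, u, p, q) ∈ W) :
    pdq g x u p q = fderiv ℝ (fun z : ℝ × ℝ × ℝ × ℝ => g z.1 z.2.1 z.2.2.1 z.2.2.2)
      (x, u, p, q) (0, 0, 0, 1) :=
  (hg.deriv_comp hW hz (t := q) ((hasDerivAt_const q x).prodMk
    ((hasDerivAt_const q u).prodMk ((hasDerivAt_const q p).prodMk (hasDerivAt_id q)))) rfl).deriv

theorem congr (hg : SmoothFnOn W g)
    (e : ∀ x u p q, (x, u, p, q) ∈ W → h x u p q = g x u p q) : SmoothFnOn W h :=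
  ContDiffOn.congr hg fun z hz => e z.1 z.2.1 z.2.2.1 z.2.2.2 hz

theorem pdx (hW : IsOpen W) (hg : SmoothFnOn W g) : SmoothFnOn W (pdx g) :=
  (smoothFunctions.contDiffOn_fderiv_apply hW hg (1, 0, 0, 0)).congr
    fun _ hz => hg.pdx_eq hW hz

theorem pdu (hW : IsOpen W) (hg : SmoothFnOn W g) : SmoothFnOn W (pdu g) :=
  (smoothFunctions.contDiffOn_fderiv_apply hW hg (0, 1, 0, 0)).congr
    fun _ hz => hg.pdu_eq hW hz

theorem pdp (hW : IsOpen W) (hg : SmoothFnOn W g) : SmoothFnOn W (pdp g) :=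
  (smoothFunctions.contDiffOn_fderiv_apply hW hg (0, 0, 1, 0)).congr
    fun _ hz => hg.pdp_eq hW hz

theorem pdq (hW : IsOpen W) (hg : SmoothFnOn W g) : SmoothFnOn W (pdq g) :=
  (smoothFunctions.contDiffOn_fderiv_apply hW hg (0, 0, 0, 1)).congr
    fun _ hz => hg.pdq_eq hW hz

theorem const (c : ℝ) : SmoothFnOn W (fun _ _ _ _ => c) := contDiffOn_const

theorem coord_p : SmoothFnOn W (fun _ _ p _ => p) :=
  (contDiff_fst.comp (contDiff_snd.comp contDiff_snd)).contDiffOn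

theorem coord_q : SmoothFnOn W (fun _ _ _ q => q) :=
  (contDiff_snd.comp (contDiff_snd.comp contDiff_snd)).contDiffOn

theorem add (hg : SmoothFnOn W g) (hh : SmoothFnOn W h) :
    SmoothFnOn W (fun x u p q => g x u p q + h x u p q) := ContDiffOn.add hg hh

theorem sub (hg : SmoothFnOn W g) (hh : SmoothFnOn W h) :
    SmoothFnOn W (fun x u p q => g x u p q - h x u p q) := ContDiffOn.sub hg hh

theorem neg (hg : SmoothFnOn W g) : SmoothFnOn W (fun x u p q => -g x u p q) :=
  ContDiffOn.neg hg

theorem mul (hg : SmoothFnOn W g) (hh : SmoothFnOn W h) :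
    SmoothFnOn W (fun x u p q => g x u p q * h x u p q) := ContDiffOn.mul hg hh

theorem pow (hg : SmoothFnOn W g) (n : ℕ) : SmoothFnOn W (fun x u p q => g x u p q ^ n) :=
  ContDiffOn.pow hg n

theorem div (hg : SmoothFnOn W g) (hh : SmoothFnOn W h)
    (h0 : ∀ x u p q, (x, u, p, q) ∈ W → h x u p q ≠ 0) :
    SmoothFnOn W (fun x u p q => g x u p q / h x u p q) :=
  ContDiffOn.div hg hh fun z hz => h0 z.1 z.2.1 z.2.2.1 z.2.2.2 hz

theorem dhat (hW : IsOpen W) (hf : SmoothFnOn W f) (hg : SmoothFnOn W g) :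
    SmoothFnOn W (Dhat f g) :=
  (((hg.pdx hW).add (coord_p.mul (hg.pdu hW))).add (coord_q.mul (hg.pdp hW))).add
    (hf.mul (hg.pdq hW))

theorem i1 (hW : IsOpen W) (hf : SmoothFnOn W f) : SmoothFnOn W (I1 f) := (hf.pdq hW).neg

theorem i2 (hW : IsOpen W) (hf : SmoothFnOn W f) : SmoothFnOn W (I2 f) :=
  (((const _).mul ((hf.i1 hW).pow 2)).sub (hf.pdp hW)).sub
    ((const _).mul (hf.dhat hW (hf.i1 hW)))

theorem i3 (hW : IsOpen W) (hf : SmoothFnOn W f) : SmoothFnOn W (I3 f) :=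
  ((((const _).mul (hf.i1 hW)).mul (hf.i2 hW)).sub (hf.pdu hW)).sub
    ((const _).mul (hf.dhat hW (hf.i2 hW)))

/-- A smooth function of `(x,u,p,q)` as an element of `smoothFunctions W`. -/
def toAlg (g : Fn) (hg : SmoothFnOn W g) : smoothFunctions W :=
  ⟨fun w => g w.1.1 w.1.2.1 w.1.2.2.1 w.1.2.2.2, _, hg, fun _ => rfl⟩

theorem toAlg_ext {hg : SmoothFnOn W g} {a : smoothFunctions W}
    (e : ∀ x u p q, ∀ hz : (x, u, p, q) ∈ W, g x u p q = a.1 ⟨(x, u, p, q), hz⟩) :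
    toAlg g hg = a :=
  Subtype.ext (funext fun w => e _ _ _ _ w.2)

open smoothFunctions in
theorem dirDeriv_x_toAlg (hW : IsOpen W) (hg : SmoothFnOn W g) :
    dirDeriv hW (1, 0, 0, 0) (toAlg g hg) = toAlg _ (hg.pdx hW) :=
  (toAlg_ext fun _ _ _ _ hz => (hg.pdx_eq hW hz).trans
    (dirDeriv_apply hW _ (toAlg g hg) (fun _ => rfl) ⟨_, hz⟩).symm).symm

open smoothFunctions in
theorem dirDeriv_u_toAlg (hW : IsOpen W) (hg : SmoothFnOn W g) :
    dirDeriv hW (0, 1, 0, 0) (toAlg g hg) = toAlg _ (hg.pdu hW) :=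
  (toAlg_ext fun _ _ _ _ hz => (hg.pdu_eq hW hz).trans
    (dirDeriv_apply hW _ (toAlg g hg) (fun _ => rfl) ⟨_, hz⟩).symm).symm

open smoothFunctions in
theorem dirDeriv_p_toAlg (hW : IsOpen W) (hg : SmoothFnOn W g) :
    dirDeriv hW (0, 0, 1, 0) (toAlg g hg) = toAlg _ (hg.pdp hW) :=
  (toAlg_ext fun _ _ _ _ hz => (hg.pdp_eq hW hz).trans
    (dirDeriv_apply hW _ (toAlg g hg) (fun _ => rfl) ⟨_, hz⟩).symm).symm

open smoothFunctions in
theorem dirDeriv_q_toAlg (hW : IsOpen W) (hg : SmoothFnOn W g) :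
    dirDeriv hW (0, 0, 0, 1) (toAlg g hg) = toAlg _ (hg.pdq hW) :=
  (toAlg_ext fun _ _ _ _ hz => (hg.pdq_eq hW hz).trans
    (dirDeriv_apply hW _ (toAlg g hg) (fun _ => rfl) ⟨_, hz⟩).symm).symm

open smoothFunctions in
theorem total_toAlg (hW : IsOpen W) (hf : SmoothFnOn W f) (hg : SmoothFnOn W g) :
    IsJetRing.total (dirDeriv hW (1, 0, 0, 0)) (dirDeriv hW (0, 1, 0, 0))
      (dirDeriv hW (0, 0, 1, 0)) (dirDeriv hW (0, 0, 0, 1)) (toAlg _ coord_p) (toAlg _ coord_q)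
      (toAlg f hf) (toAlg g hg) = toAlg _ (hf.dhat hW hg) := by
  rw [IsJetRing.total_apply, dirDeriv_x_toAlg, dirDeriv_u_toAlg, dirDeriv_p_toAlg,
    dirDeriv_q_toAlg]
  rfl

open smoothFunctions in
theorem isJetRing (hW : IsOpen W) :
    IsJetRing (dirDeriv hW (1, 0, 0, 0)) (dirDeriv hW (0, 1, 0, 0))
      (dirDeriv hW (0, 0, 1, 0)) (dirDeriv hW (0, 0, 0, 1)) (toAlg _ coord_p)
      (toAlg _ coord_q) where
  dx_du := dirDeriv_comm hW _ _
  dx_dp := dirDeriv_comm hW _ _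
  dx_dq := dirDeriv_comm hW _ _
  du_dp := dirDeriv_comm hW _ _
  du_dq := dirDeriv_comm hW _ _
  dp_dq := dirDeriv_comm hW _ _
  dx_p := by rw [dirDeriv_x_toAlg]; exact toAlg_ext fun x _ p _ _ => deriv_const x p
  du_p := by rw [dirDeriv_u_toAlg]; exact toAlg_ext fun _ u p _ _ => deriv_const u p
  dp_p := by rw [dirDeriv_p_toAlg]; exact toAlg_ext fun _ _ p _ _ => deriv_id p
  dq_p := by rw [dirDeriv_q_toAlg]; exact toAlg_ext fun _ _ p q _ => deriv_const q p
  dx_q := by rw [dirDeriv_x_toAlg]; exact toAlg_ext fun x _ _ q _ => deriv_const x q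
  du_q := by rw [dirDeriv_u_toAlg]; exact toAlg_ext fun _ u _ q _ => deriv_const u q
  dp_q := by rw [dirDeriv_p_toAlg]; exact toAlg_ext fun _ _ p q _ => deriv_const p q
  dq_q := by rw [dirDeriv_q_toAlg]; exact toAlg_ext fun _ _ _ q _ => deriv_id q

theorem isUnit_toAlg (hg : SmoothFnOn W g)
    (h0 : ∀ x u p q, (x, u, p, q) ∈ W → g x u p q ≠ 0) : IsUnit (toAlg g hg) :=
  IsUnit.of_mul_eq_one (toAlg _ ((const 1).div hg h0))
    (Subtype.ext (funext fun w => mul_one_div_cancel (h0 _ _ _ _ w.2)))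

end SmoothFnOn

/-- The 2-jet of a function of one variable. -/
def jet2 (y : ℝ → ℝ) (t : ℝ) : ℝ × ℝ × ℝ × ℝ := (t, y t, deriv y t, deriv (deriv y) t)

theorem SmoothFnOn.hasDerivAt_comp_of_vectorField {W : Set (ℝ × ℝ × ℝ × ℝ)} {f g : Fn}
    (hW : IsOpen W) (hg : SmoothFnOn W g) {γ : ℝ → ℝ × ℝ × ℝ × ℝ} {t x u p q : ℝ}
    (hγt : γ t = (x, u, p, q)) (hz : (x, u, p, q) ∈ W)
    (hγ : HasDerivAt γ (1, p, q, f x u p q) t) :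
    HasDerivAt (fun t => g (γ t).1 (γ t).2.1 (γ t).2.2.1 (γ t).2.2.2) (Dhat f g x u p q) t := by
  refine (hg.deriv_comp hW hz hγ hγt).congr_deriv ?_
  have e : ((1, p, q, f x u p q) : ℝ × ℝ × ℝ × ℝ) = (1, 0, 0, 0) + p • (0, 1, 0, 0)
      + q • (0, 0, 1, 0) + f x u p q • (0, 0, 0, 1) := by
    simp
  rw [e]
  simp only [map_add, map_smul, smul_eq_mul, Dhat, hg.pdx_eq hW hz, hg.pdu_eq hW hz,
    hg.pdp_eq hW hz, hg.pdq_eq hW hz]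

theorem ContDiffOn.deriv_of_isOpen_top {y : ℝ → ℝ} {I : Set ℝ} (hI : IsOpen I)
    (hy : ContDiffOn ℝ ∞ y I) : ContDiffOn ℝ ∞ (deriv y) I :=
  hy.deriv_of_isOpen hI (by simp)

namespace SolvesODE3

variable {f g : Fn} {I : Set ℝ} {y : ℝ → ℝ}

theorem contDiffOn_jet2 (hI : IsOpen I) (hy : SolvesODE3 f I y) : ContDiffOn ℝ ∞ (jet2 y) I :=
  have h1 := hy.1.deriv_of_isOpen_top hI
  contDiffOn_id.prodMk (hy.1.prodMk (h1.prodMk (h1.deriv_of_isOpen_top hI)))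

theorem hasDerivAt_jet2 (hI : IsOpen I) (hy : SolvesODE3 f I y) {t : ℝ} (ht : t ∈ I) :
    HasDerivAt (jet2 y)
      (1, deriv y t, deriv (deriv y) t, f t (y t) (deriv y t) (deriv (deriv y) t)) t := by
  have h1 := hy.1.deriv_of_isOpen_top hI
  have h2 := h1.deriv_of_isOpen_top hI
  have key : ∀ {w : ℝ → ℝ}, ContDiffOn ℝ ∞ w I → HasDerivAt w (deriv w t) t := fun hw =>
    ((hw.contDiffAt (hI.mem_nhds ht)).differentiableAt (by simp)).hasDerivAt
  have := (hasDerivAt_id t).prodMk ((key hy.1).prodMk ((key h1).prodMk (key h2)))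
  rwa [hy.2 t ht] at this

theorem hasDerivAt_comp_jet2 {W : Set (ℝ × ℝ × ℝ × ℝ)} (hW : IsOpen W) (hg : SmoothFnOn W g)
    (hI : IsOpen I) (hy : SolvesODE3 f I y) {t : ℝ} (ht : t ∈ I) (hz : jet2 y t ∈ W) :
    HasDerivAt (fun t => g t (y t) (deriv y t) (deriv (deriv y) t))
      (Dhat f g t (y t) (deriv y t) (deriv (deriv y) t)) t :=
  hg.hasDerivAt_comp_of_vectorField hW rfl hz (hy.hasDerivAt_jet2 hI ht)

end SolvesODE3

/-- Local existence of solutions of `u''' = f(x,u,u',u'')` with prescribed initial 2-jet. -/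
theorem exists_solvesODE3 {f : Fn} {W : Set (ℝ × ℝ × ℝ × ℝ)} (hW : IsOpen W)
    (hf : SmoothFnOn W f) {x u p q : ℝ} (hz : (x, u, p, q) ∈ W) :
    ∃ (I : Set ℝ) (y : ℝ → ℝ), IsOpen I ∧ I.OrdConnected ∧ x ∈ I ∧ SolvesODE3 f I y ∧
      (∀ t ∈ I, jet2 y t ∈ W) ∧ jet2 y x = (x, u, p, q) := by
  set V : ℝ × ℝ × ℝ × ℝ → ℝ × ℝ × ℝ × ℝ :=
    fun z => (1, z.2.2.1, z.2.2.2, f z.1 z.2.1 z.2.2.1 z.2.2.2) with hV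
  have hVs : ContDiffOn ℝ ∞ V W :=
    contDiffOn_const.prodMk (SmoothFnOn.coord_p.prodMk (SmoothFnOn.coord_q.prodMk hf))
  obtain ⟨α, hα0, ε, hε, hα⟩ :=
    ((hVs.contDiffAt (hW.mem_nhds hz)).of_le (by simp))
      |>.exists_forall_mem_closedBall_exists_eq_forall_mem_Ioo_hasDerivAt₀ x
  have hx : x ∈ Set.Ioo (x - ε) (x + ε) := ⟨by linarith, by linarith⟩
  have hmem : ∀ᶠ t in nhds x, α t ∈ W :=
    (hα x hx).continuousAt.eventually_mem (by rw [hα0]; exact hW.mem_nhds hz)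
  obtain ⟨δ, hδ, hδW⟩ := Metric.eventually_nhds_iff_ball.1 hmem
  set I := Metric.ball x (min ε δ) with hIdef
  have hI : IsOpen I := Metric.isOpen_ball
  have hIε : ∀ t ∈ I, HasDerivAt α (V (α t)) t := fun t ht =>
    hα t (by rw [← Real.ball_eq_Ioo]; exact Metric.ball_subset_ball (min_le_left _ _) ht)
  have hIW : ∀ t ∈ I, α t ∈ W := fun t ht =>
    hδW t (Metric.ball_subset_ball (min_le_right _ _) ht)
  have hxI : x ∈ I := Metric.mem_ball_self (lt_min hε hδ)
  have hIc : I.OrdConnected := by rw [hIdef, Real.ball_eq_Ioo]; exact Set.ordConnected_Ioo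
  have d0 : ∀ t ∈ I, HasDerivAt (fun t => (α t).1) 1 t := fun t ht => (hIε t ht).fst
  have d1 : ∀ t ∈ I, HasDerivAt (fun t => (α t).2.1) (α t).2.2.1 t :=
    fun t ht => (hIε t ht).snd.fst
  have d2 : ∀ t ∈ I, HasDerivAt (fun t => (α t).2.2.1) (α t).2.2.2 t :=
    fun t ht => (hIε t ht).snd.snd.fst
  have d3 : ∀ t ∈ I, HasDerivAt (fun t => (α t).2.2.2)
      (f (α t).1 (α t).2.1 (α t).2.2.1 (α t).2.2.2) t := fun t ht => (hIε t ht).snd.snd.snd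
  have hfst : ∀ t ∈ I, (α t).1 = t := by
    refine hI.eqOn_of_deriv_eq hIc.isPreconnected
      (fun t ht => (d0 t ht).differentiableAt.differentiableWithinAt)
      differentiableOn_id (fun t ht => ?_) hxI (by rw [hα0])
    rw [(d0 t ht).deriv]
    exact (hasDerivAt_id t).deriv.symm
  have e1 : Set.EqOn (deriv fun t => (α t).2.1) (fun t => (α t).2.2.1) I :=
    fun t ht => (d1 t ht).deriv
  have e2 : Set.EqOn (deriv (deriv fun t => (α t).2.1)) (fun t => (α t).2.2.2) I :=
    fun t ht => ((e1.eventuallyEq_of_mem (hI.mem_nhds ht)).deriv_eq).trans (d2 t ht).deriv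
  have hjet : ∀ t ∈ I, jet2 (fun t => (α t).2.1) t = α t := fun t ht => by
    simp only [jet2, e1 ht, e2 ht]
    ext <;> simp [hfst t ht]
  have hsm : ∀ n : ℕ, ContDiffOn ℝ n α I := by
    intro n
    induction n with
    | zero => exact contDiffOn_zero.2 fun t ht => (hIε t ht).continuousAt.continuousWithinAt
    | succ n ih =>
      rw [Nat.cast_succ, contDiffOn_succ_iff_deriv_of_isOpen hI]
      refine ⟨fun t ht => (hIε t ht).differentiableAt.differentiableWithinAt, by simp, ?_⟩
      exact ((hVs.of_le (by exact_mod_cast le_top)).comp ih hIW).congr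
        fun t ht => (hIε t ht).deriv
  refine ⟨I, fun t => (α t).2.1, hI, hIc, hxI, ⟨(contDiffOn_infty.2 hsm).snd.fst, ?_⟩, ?_, ?_⟩
  · intro t ht
    rw [(e2.eventuallyEq_of_mem (hI.mem_nhds ht)).deriv_eq, (d3 t ht).deriv, hfst t ht, e2 ht,
      e1 ht]
  · intro t ht
    rw [hjet t ht]
    exact hIW t ht
  · rw [hjet x hxI, hα0]

/-- A contact equivalence maps `u''' = f` to the target equation: the third derivative of the
image curve is computed by differentiating `η = D̂ₓχ/D̂ₓφ` along solutions. -/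
theorem ContactEquivOn.dhat_eq {f fbar : Fn} {U : Set (ℝ × ℝ × ℝ)} {φ ψ χ : Fn3}
    (heqv : ContactEquivOn f fbar U φ ψ χ) {W : Set (ℝ × ℝ × ℝ × ℝ)} (hW : IsOpen W)
    (hf : SmoothFnOn W f) (hφ : SmoothFnOn W (lift φ)) (hχ : SmoothFnOn W (lift χ))
    (hWU : ∀ x u p q, (x, u, p, q) ∈ W → (x, u, p) ∈ U)
    (hs : ∀ x u p q, (x, u, p, q) ∈ W → Dhat f (lift φ) x u p q ≠ 0)
    {η : Fn} (hη : η = fun x u p q => Dhat f (lift χ) x u p q / Dhat f (lift φ) x u p q)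
    {x u p q : ℝ} (hz : (x, u, p, q) ∈ W) :
    Dhat f η x u p q
      = fbar (φ x u p) (ψ x u p) (χ x u p) (η x u p q) * Dhat f (lift φ) x u p q := by
  obtain ⟨I, y, hI, hIc, hxI, hy, hyW, hjet⟩ := exists_solvesODE3 hW hf hz
  have hηs : SmoothFnOn W η := hη ▸ (hf.dhat hW hχ).div (hf.dhat hW hφ) hs
  set Φ : ℝ → ℝ := fun t => φ t (y t) (deriv y t) with hΦ
  have dΦ : ∀ t ∈ I, HasDerivAt Φ
      (Dhat f (lift φ) t (y t) (deriv y t) (deriv (deriv y) t)) t :=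
    fun t ht => hy.hasDerivAt_comp_jet2 hW hφ hI ht (hyW t ht)
  have hs' : ∀ t ∈ I, Dhat f (lift φ) t (y t) (deriv y t) (deriv (deriv y) t) ≠ 0 :=
    fun t ht => hs _ _ _ _ (hyW t ht)
  obtain ⟨v, hv, hvψ, hvχ, hv3⟩ := heqv I y hI hIc hy (fun t ht => hWU _ _ _ _ (hyW t ht))
    (fun t ht => by rw [(dΦ t ht).deriv]; exact hs' t ht)
  have hΦs : ContDiffOn ℝ ∞ Φ I := hφ.comp (hy.contDiffOn_jet2 hI) hyW
  have hΩ : IsOpen (Φ '' I) := by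
    rw [isOpen_iff_mem_nhds]
    rintro _ ⟨t, ht, rfl⟩
    have := ((hΦs.contDiffAt (hI.mem_nhds ht)).hasStrictDerivAt' (dΦ t ht) (by simp))
    rw [← this.map_nhds_eq (hs' t ht)]
    exact Filter.image_mem_map (hI.mem_nhds ht)
  have step : ∀ {w : ℝ → ℝ} {g : Fn}, ContDiffOn ℝ ∞ w (Φ '' I) → SmoothFnOn W g →
      (∀ t ∈ I, w (Φ t) = g t (y t) (deriv y t) (deriv (deriv y) t)) → ∀ t ∈ I,
      deriv w (Φ t) * Dhat f (lift φ) t (y t) (deriv y t) (deriv (deriv y) t)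
        = Dhat f g t (y t) (deriv y t) (deriv (deriv y) t) := by
    intro w g hw hg e t ht
    have h1 := ((hw.contDiffAt (hΩ.mem_nhds ⟨t, ht, rfl⟩)).differentiableAt
      (by simp)).hasDerivAt.comp t (dΦ t ht)
    have h2 := hy.hasDerivAt_comp_jet2 hW hg hI ht (hyW t ht)
    refine h1.unique (h2.congr_of_eventuallyEq ?_)
    filter_upwards [hI.mem_nhds ht] with r hr using e r hr
  have hv1 := hv.deriv_of_isOpen_top hΩ
  have hv2 := hv1.deriv_of_isOpen_top hΩ
  have e2 : ∀ t ∈ I, deriv (deriv v) (Φ t) = η t (y t) (deriv y t) (deriv (deriv y) t) := by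
    intro t ht
    rw [hη]
    exact eq_div_of_mul_eq (hs' t ht) (step hv1 hχ hvχ t ht)
  have e3 := step hv2 hηs e2 x hxI
  simp only [jet2, Prod.mk.injEq, true_and] at hjet
  obtain ⟨hu, hp, hq⟩ := hjet
  rw [hv3 _ ⟨x, hxI, rfl⟩, e2 x hxI] at e3
  simp only at e3
  rw [hvψ x hxI, hvχ x hxI, hu, hp, hq] at e3
  exact e3.symm

theorem cbrt_neg_pow_three (y : ℝ) : cbrt (-y ^ 3) = -y := by
  have key : ∀ a : ℝ, 0 ≤ a → (a ^ 3) ^ ((1 : ℝ) / 3) = a := fun a ha => by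
    rw [← Real.rpow_natCast a 3, ← Real.rpow_mul ha]
    norm_num
  unfold cbrt
  rcases le_or_gt y 0 with hy | hy
  · rw [if_pos (by rw [← Odd.neg_pow (by decide)]; exact pow_nonneg (neg_nonneg.2 hy) 3),
      ← Odd.neg_pow (by decide), key _ (neg_nonneg.2 hy)]
  · rw [if_neg (by simpa using pow_pos hy 3), neg_neg, key _ hy.le]

namespace SmoothFnOn

variable {W : Set (ℝ × ℝ × ℝ × ℝ)} {f g : Fn} {a : ℝ → ℝ}

theorem comp_left (ha : ContDiff ℝ ∞ a) (hg : SmoothFnOn W g) :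
    SmoothFnOn W (fun x u p q => a (g x u p q)) := ha.comp_contDiffOn hg

open smoothFunctions in
theorem dirDeriv_comp_left (hW : IsOpen W) (ha : ContDiff ℝ ∞ a) (ha' : ContDiff ℝ ∞ (deriv a))
    (hg : SmoothFnOn W g) (v : ℝ × ℝ × ℝ × ℝ) :
    dirDeriv hW v (toAlg _ (hg.comp_left ha))
      = toAlg _ (hg.comp_left ha') * dirDeriv hW v (toAlg g hg) := by
  refine Subtype.ext (funext fun w => ?_)
  refine (dirDeriv_apply hW v (toAlg _ (hg.comp_left ha))
    (G := fun z => a (g z.1 z.2.1 z.2.2.1 z.2.2.2)) (fun _ => rfl) w).trans ?_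
  have h := (ha.differentiable (by simp) (g w.1.1 w.1.2.1 w.1.2.2.1 w.1.2.2.2)).hasDerivAt
  have := h.comp_hasFDerivAt w.1 (hg.differentiableAt hW w.2).hasFDerivAt
  refine (congrArg (· v) this.fderiv).trans ?_
  exact congrArg (deriv a _ * ·) (dirDeriv_apply hW v (toAlg g hg) (fun _ => rfl) w).symm

open smoothFunctions in
theorem total_comp_left (hW : IsOpen W) (ha : ContDiff ℝ ∞ a) (ha' : ContDiff ℝ ∞ (deriv a))
    (hg : SmoothFnOn W g) (P Q F : smoothFunctions W) :
    IsJetRing.total (dirDeriv hW (1, 0, 0, 0)) (dirDeriv hW (0, 1, 0, 0))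
        (dirDeriv hW (0, 0, 1, 0)) (dirDeriv hW (0, 0, 0, 1)) P Q F
        (toAlg _ (hg.comp_left ha))
      = toAlg _ (hg.comp_left ha') *
        IsJetRing.total (dirDeriv hW (1, 0, 0, 0)) (dirDeriv hW (0, 1, 0, 0))
          (dirDeriv hW (0, 0, 1, 0)) (dirDeriv hW (0, 0, 0, 1)) P Q F (toAlg g hg) := by
  simp only [IsJetRing.total_apply, dirDeriv_comp_left hW ha ha' hg]
  ring

end SmoothFnOn

namespace smoothFunctions

variable {W : Set (ℝ × ℝ × ℝ × ℝ)}

/-- Evaluation at a point, as an algebra homomorphism. -/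
def eval (w : W) : smoothFunctions W →ₐ[ℝ] ℝ :=
  (Pi.evalAlgHom ℝ (fun _ : W => ℝ) w).comp (smoothFunctions W).val

theorem eval_toAlg {g : Fn} (hg : SmoothFnOn W g) (w : W) :
    eval w (hg.toAlg) = g w.1.1 w.1.2.1 w.1.2.2.1 w.1.2.2.2 := rfl

theorem ext_eval {a b : smoothFunctions W}
    (e : ∀ x u p q, ∀ hz : (x, u, p, q) ∈ W, eval ⟨_, hz⟩ a = eval ⟨_, hz⟩ b) : a = b :=
  Subtype.ext (funext fun w => e _ _ _ _ w.2)

end smoothFunctions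

theorem pdq_lift (g : Fn3) (x u p q : ℝ) : pdq (lift g) x u p q = 0 := deriv_const q (g x u p)

open smoothFunctions SmoothFnOn in
theorem isContact_toAlg {W : Set (ℝ × ℝ × ℝ × ℝ)} (hW : IsOpen W) {φ ψ χ lam : Fn3}
    (hφ : SmoothFnOn W (lift φ)) (hψ : SmoothFnOn W (lift ψ))
    (hχ : SmoothFnOn W (lift χ)) (hlam : SmoothFnOn W (lift lam))
    (hp : ∀ x u p q, (x, u, p, q) ∈ W → pdp3 ψ x u p = χ x u p * pdp3 φ x u p)
    (hu : ∀ x u p q, (x, u, p, q) ∈ W →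
      pdu3 ψ x u p = χ x u p * pdu3 φ x u p + lam x u p)
    (hx : ∀ x u p q, (x, u, p, q) ∈ W →
      pdx3 ψ x u p = χ x u p * pdx3 φ x u p - p * lam x u p) :
    IsJetRing.IsContact (dirDeriv hW (1, 0, 0, 0)) (dirDeriv hW (0, 1, 0, 0))
      (dirDeriv hW (0, 0, 1, 0)) (dirDeriv hW (0, 0, 0, 1)) (toAlg _ coord_p)
      (toAlg _ hφ) (toAlg _ hψ) (toAlg _ hχ) (toAlg _ hlam) where
  dq_φ := by rw [dirDeriv_q_toAlg]; exact toAlg_ext fun _ _ _ _ _ => pdq_lift ..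
  dq_ψ := by rw [dirDeriv_q_toAlg]; exact toAlg_ext fun _ _ _ _ _ => pdq_lift ..
  dq_χ := by rw [dirDeriv_q_toAlg]; exact toAlg_ext fun _ _ _ _ _ => pdq_lift ..
  dq_lam := by rw [dirDeriv_q_toAlg]; exact toAlg_ext fun _ _ _ _ _ => pdq_lift ..
  dp_ψ := by simp only [dirDeriv_p_toAlg]; exact toAlg_ext hp
  du_ψ := by simp only [dirDeriv_u_toAlg]; exact toAlg_ext hu
  dx_ψ := by simp only [dirDeriv_x_toAlg]; exact toAlg_ext hx

open smoothFunctions SmoothFnOn in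
/-- For a contact transformation, `D̂ₓφ` vanishes on no nonempty open set. -/
theorem notMem_of_dhat_eq_zero {W : Set (ℝ × ℝ × ℝ × ℝ)} (hW : IsOpen W) {f : Fn}
    {φ ψ χ lam : Fn3} (hf : SmoothFnOn W f)
    (hφ : SmoothFnOn W (lift φ)) (hψ : SmoothFnOn W (lift ψ))
    (hχ : SmoothFnOn W (lift χ)) (hlam : SmoothFnOn W (lift lam))
    (hp : ∀ x u p q, (x, u, p, q) ∈ W → pdp3 ψ x u p = χ x u p * pdp3 φ x u p)
    (hu : ∀ x u p q, (x, u, p, q) ∈ W →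
      pdu3 ψ x u p = χ x u p * pdu3 φ x u p + lam x u p)
    (hx : ∀ x u p q, (x, u, p, q) ∈ W →
      pdx3 ψ x u p = χ x u p * pdx3 φ x u p - p * lam x u p)
    (hlam0 : ∀ x u p q, (x, u, p, q) ∈ W → lam x u p ≠ 0)
    (hs : ∀ x u p q, (x, u, p, q) ∈ W → Dhat f (lift φ) x u p q = 0) {x u p q : ℝ} :
    (x, u, p, q) ∉ W := by
  intro hz
  have hcon := isContact_toAlg hW hφ hψ hχ hlam hp hu hx
  have h0 := (total_toAlg hW hf hφ).trans (toAlg_ext (a := 0) hs)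
  have h1 := (isJetRing hW).dq_total (toAlg f hf) (toAlg _ hφ)
  have h2 := (isJetRing hW).lam_eq hcon (toAlg f hf)
  simp only [h0, hcon.dq_φ, map_zero, mul_zero, add_zero, zero_add] at h1
  rw [h0, ← h1, mul_zero, zero_mul, sub_zero] at h2
  exact hlam0 x u p q hz (congrArg (eval ⟨_, hz⟩) h2)

open smoothFunctions SmoothFnOn in
/-- The invariants and the contact transformation, where `D̂ₓφ` does not vanish. -/
theorem contact_system_of_ne_zero {W : Set (ℝ × ℝ × ℝ × ℝ)} (hW : IsOpen W)
    {f η : Fn} {φ ψ χ lam : Fn3} {abar : ℝ → ℝ}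
    (hf : SmoothFnOn W f) (hφ : SmoothFnOn W (lift φ)) (hψ : SmoothFnOn W (lift ψ))
    (hχ : SmoothFnOn W (lift χ)) (hlam : SmoothFnOn W (lift lam))
    (habar : ContDiff ℝ ∞ abar) (habar0 : ∀ t, abar t ≠ 0)
    (hp : ∀ x u p q, (x, u, p, q) ∈ W → pdp3 ψ x u p = χ x u p * pdp3 φ x u p)
    (hu : ∀ x u p q, (x, u, p, q) ∈ W →
      pdu3 ψ x u p = χ x u p * pdu3 φ x u p + lam x u p)
    (hx : ∀ x u p q, (x, u, p, q) ∈ W →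
      pdx3 ψ x u p = χ x u p * pdx3 φ x u p - p * lam x u p)
    (hlam0 : ∀ x u p q, (x, u, p, q) ∈ W → lam x u p ≠ 0)
    (hs : ∀ x u p q, (x, u, p, q) ∈ W → Dhat f (lift φ) x u p q ≠ 0)
    (hη : η = fun x u p q => Dhat f (lift χ) x u p q / Dhat f (lift φ) x u p q)
    (hode : ∀ x u p q, (x, u, p, q) ∈ W → Dhat f η x u p q
      = abar (φ x u p) ^ 3 * ψ x u p * Dhat f (lift φ) x u p q)
    {H : Fn3} (hH : H = fun x u p => deriv abar (φ x u p) / abar (φ x u p) ^ 2)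
    {x u p q : ℝ} (hz : (x, u, p, q) ∈ W) :
    (abar (φ x u p) * Dhat f (lift φ) x u p q) ^ 3 = -I3 f x u p q ∧
    J3 f x u p q = -(abar (φ x u p) * Dhat f (lift φ) x u p q) ∧
    I4 f x u p q = -(abar (φ x u p) * pdp3 φ x u p) ∧
    I7 f x u p q = -(abar (φ x u p) * pdu3 φ x u p) ∧
    Dhat f (lift fun x u p => abar (φ x u p)) x u p q
      = H x u p * abar (φ x u p) ^ 2 * Dhat f (lift φ) x u p q ∧
    Dhat f (lift lam) x u p q = J3 f x u p q * (H x u p + I5 f x u p q) * lam x u p ∧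
    pdu3 lam x u p = (H x u p * I7 f x u p q - Qinv f x u p q) * lam x u p ∧
    Dhat f (lift φ) x u p q * pdp3 lam x u p
      = lam x u p * (J3 f x u p q * (H x u p + I5 f x u p q) * pdp3 φ x u p
        - pdu3 φ x u p) ∧
    -2 * J3 f x u p q * Dhat f (lift H) x u p q + J3 f x u p q ^ 2 * H x u p ^ 2
      = 2 * J3 f x u p q * Dhat f (I5 f) x u p q - I2 f x u p q
        + J3 f x u p q ^ 2 * I5 f x u p q ^ 2 ∧
    Dhat f (lift φ) x u p q ^ 2 * pdq η x u p q = lam x u p ∧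
    3 * (pdp η x u p q - abar (φ x u p) ^ 3 * ψ x u p * pdp3 φ x u p)
      = pdq η x u p q
        * (3 * (J3 f x u p q * (H x u p + I5 f x u p q)) + I1 f x u p q) ∧
    2 * (pdu η x u p q - abar (φ x u p) ^ 3 * ψ x u p * pdu3 φ x u p)
      = pdq η x u p q
        * ((J3 f x u p q * (H x u p + I5 f x u p q)) ^ 2 + I2 f x u p q) ∧
    pdp3 χ x u p - η x u p q * pdp3 φ x u p
      = Dhat f (lift φ) x u p q * pdq η x u p q ∧
    pdu3 χ x u p - η x u p q * pdu3 φ x u p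
      = Dhat f (lift φ) x u p q * pdq η x u p q
        * (J3 f x u p q * (H x u p + I5 f x u p q)) := by
  have habar' : ContDiff ℝ ∞ (deriv abar) := (contDiff_infty_iff_deriv.1 habar).2
  have hc : ContDiff ℝ ∞ fun t => deriv abar t / abar t ^ 2 :=
    habar'.div (habar.pow 2) fun t => pow_ne_zero 2 (habar0 t)
  have hc' := (contDiff_infty_iff_deriv.1 hc).2
  have hss := hf.dhat hW hφ
  have hηs : SmoothFnOn W η := hη ▸ (hf.dhat hW hχ).div hss hs
  have hFs : SmoothFnOn W fun x u p _ => abar (φ x u p) ^ 3 * ψ x u p :=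
    ((hφ.comp_left habar).pow 3).mul hψ
  set t : Fn := fun x u p q =>
    (3 * Dhat f (Dhat f (lift φ)) x u p q + I1 f x u p q * Dhat f (lift φ) x u p q)
      / (3 * Dhat f (lift φ) x u p q) with ht
  have hts : SmoothFnOn W t :=
    (((const 3).mul (hf.dhat hW hss)).add ((hf.i1 hW).mul hss)).div ((const 3).mul hss)
      fun x u p q hz => mul_ne_zero three_ne_zero (hs x u p q hz)
  have hjet := isJetRing hW
  have hcon := isContact_toAlg hW hφ hψ hχ hlam hp hu hx
  have hφq := hcon.dq_φ
  have us := isUnit_toAlg hss hs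
  have ulam := isUnit_toAlg hlam hlam0
  have ub := isUnit_toAlg (hφ.comp_left habar) fun x u p _ _ => habar0 (φ x u p)
  have hst := (total_toAlg hW hf hφ).symm
  have hbt := total_comp_left hW habar habar' hφ (toAlg _ coord_p) (toAlg _ coord_q) (toAlg _ hf)
  have hcq : ∀ {a : ℝ → ℝ} (ha : ContDiff ℝ ∞ a), ContDiff ℝ ∞ (deriv a) →
      dirDeriv hW (0, 0, 0, 1) (toAlg _ (hφ.comp_left ha)) = 0 := fun ha ha' => by
    rw [dirDeriv_comp_left hW ha ha' hφ, hφq, mul_zero]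
  have htq : 3 * toAlg _ hss * toAlg _ hts
      = 3 * toAlg _ (hf.dhat hW hss) + toAlg _ (hf.i1 hW) * toAlg _ hss :=
    ext_eval fun x u p q hz => by
      have := hs x u p q hz
      simp only [map_mul, map_add, map_ofNat, eval_toAlg, ht]
      field_simp
  obtain ⟨k1, k2, k3, k4, k5, k6, k7, k8, k9⟩ := hjet.contact_system hcon (f := toAlg f hf)
    (F := toAlg _ hFs) (b := toAlg _ (hφ.comp_left habar)) (η := toAlg _ hηs)
    (b1 := toAlg _ (hφ.comp_left habar')) (t := toAlg _ hts) (I₁ := toAlg _ (hf.i1 hW))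
    (I₂ := toAlg _ (hf.i2 hW)) (I₃ := toAlg _ (hf.i3 hW)) hst
    (by
      rw [total_toAlg]
      refine ext_eval fun x u p q hz => ?_
      simp only [map_mul, eval_toAlg, hη]
      exact div_mul_cancel₀ _ (hs x u p q hz))
    rfl (by rw [total_toAlg]; exact toAlg_ext hode)
    (dirDeriv_comp_left hW habar habar' hφ _) (dirDeriv_comp_left hW habar habar' hφ _)
    (hcq habar habar') (by rw [hbt, ← hst])
    (by rw [total_toAlg, htq])
    (by rw [dirDeriv_q_toAlg]; rfl)
    (by
      rw [dirDeriv_p_toAlg, total_toAlg]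
      refine ext_eval fun x u p q hz => ?_
      simp only [map_mul, map_sub, map_pow, map_neg, map_ofNat, eval_toAlg, I2]
      ring)
    (by
      rw [dirDeriv_u_toAlg, total_toAlg]
      refine ext_eval fun x u p q hz => ?_
      simp only [map_mul, map_sub, map_neg, map_ofNat, eval_toAlg, I3]
      ring)
    us ulam
  have hI3 : ∀ x u p q, (x, u, p, q) ∈ W →
      (abar (φ x u p) * Dhat f (lift φ) x u p q) ^ 3 = -I3 f x u p q := fun x u p q hz => by
    have := congrArg (eval ⟨_, hz⟩) k1
    simp only [map_mul, map_pow, map_neg, eval_toAlg] at this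
    exact this
  have hJ : ∀ x u p q, (x, u, p, q) ∈ W →
      J3 f x u p q = -(abar (φ x u p) * Dhat f (lift φ) x u p q) := fun x u p q hz => by
    rw [J3, ← cbrt_neg_pow_three, hI3 x u p q hz, neg_neg]
  have hJ0 : ∀ x u p q, (x, u, p, q) ∈ W → J3 f x u p q ≠ 0 := fun x u p q hz => by
    rw [hJ x u p q hz]
    exact neg_ne_zero.2 (mul_ne_zero (habar0 _) (hs x u p q hz))
  have hJs : SmoothFnOn W (J3 f) := (((hφ.comp_left habar).mul hss).neg).congr hJ
  have h5s : SmoothFnOn W (I5 f) :=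
    ((const 1).div ((const 3).mul (hJs.pow 2)) fun x u p q hz =>
      mul_ne_zero three_ne_zero (pow_ne_zero 2 (hJ0 x u p q hz))).mul
      (((hf.i1 hW).mul hJs).add ((const 3).mul (hf.dhat hW hJs)))
  have h4s : SmoothFnOn W (I4 f) := hJs.pdq hW
  have h7s : SmoothFnOn W (I7 f) := ((h5s.pdq hW).neg).mul (hJs.pow 2)
  have hQs : SmoothFnOn W (Qinv f) :=
    (((((hf.i1 hW).mul h7s).add (((const 3).mul (hJs.pow 2)).mul (h5s.pdp hW))).add
      ((const 3).mul (hJs.pdu hW))).sub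
      ((((const 3).mul hJs).mul h4s).mul (hf.dhat hW h5s))).neg.div ((const 3).mul hJs)
      fun x u p q hz => mul_ne_zero three_ne_zero (hJ0 x u p q hz)
  obtain ⟨m1, m2, m3, m4, m5⟩ := hjet.contact_invariants hcon (f := toAlg f hf)
    (b := toAlg _ (hφ.comp_left habar)) (H := toAlg _ (hφ.comp_left hc))
    (b1 := toAlg _ (hφ.comp_left habar')) (h1 := toAlg _ (hφ.comp_left hc'))
    (t := toAlg _ hts) (J := toAlg _ hJs) (I₁ := toAlg _ (hf.i1 hW))
    (I₂ := toAlg _ (hf.i2 hW)) (I₄ := toAlg _ h4s) (I₅ := toAlg _ h5s) (I₇ := toAlg _ h7s)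
    (Q := toAlg _ hQs) hst
    (ext_eval fun x u p q hz => by
      simp only [map_mul, map_pow, eval_toAlg]
      exact (div_mul_cancel₀ _ (pow_ne_zero 2 (habar0 _))).symm)
    (dirDeriv_comp_left hW habar habar' hφ _) (dirDeriv_comp_left hW habar habar' hφ _)
    (hcq habar habar') (by rw [hbt, ← hst])
    (dirDeriv_comp_left hW hc hc' hφ _) (hcq hc hc')
    (by rw [total_comp_left hW hc hc' hφ, ← hst])
    (by rw [total_toAlg, htq])
    (toAlg_ext hJ) (by rw [dirDeriv_q_toAlg]; rfl)
    (by
      rw [total_toAlg]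
      refine ext_eval fun x u p q hz => ?_
      have := hJ0 x u p q hz
      simp only [map_mul, map_add, map_pow, map_ofNat, eval_toAlg, I5]
      field_simp)
    (by rw [dirDeriv_q_toAlg]; rfl)
    (by
      rw [dirDeriv_p_toAlg, dirDeriv_u_toAlg, total_toAlg]
      refine ext_eval fun x u p q hz => ?_
      have := hJ0 x u p q hz
      simp only [map_mul, map_add, map_sub, map_neg, map_pow, map_ofNat, eval_toAlg, Qinv]
      field_simp)
    us ub ulam k2 k3 k4
  have e : ∀ {a b : smoothFunctions W}, a = b → eval ⟨_, hz⟩ a = eval ⟨_, hz⟩ b :=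
    fun h => congrArg _ h
  rw [m1] at k2 k3 k6 k7 k9
  rw [← hst, total_toAlg] at hbt
  simp only [total_toAlg, dirDeriv_p_toAlg, dirDeriv_u_toAlg, dirDeriv_q_toAlg]
    at k2 k3 k5 k6 k7 k8 k9 m2 m3 m4 m5
  replace hbt := e hbt
  replace k2 := e k2
  replace k3 := e k3
  replace k5 := e k5
  replace k6 := e k6
  replace k7 := e k7
  replace k8 := e k8
  replace k9 := e k9
  replace m2 := e m2
  replace m3 := e m3
  replace m4 := e m4
  replace m5 := e m5
  simp only [map_mul, map_add, map_sub, map_neg, map_pow, map_ofNat, eval_toAlg]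
    at hbt k2 k3 k5 k6 k7 k8 k9 m2 m3 m4 m5
  subst hH
  refine ⟨hI3 x u p q hz, hJ x u p q hz, m2, m3, hbt.trans ?_, k2.trans (mul_comm _ _), m4, k3, m5, k5, k6, k7,
    k8, k9⟩
  exact congrArg (· * _) (div_mul_cancel₀ _ (pow_ne_zero 2 (habar0 _))).symm
/-- If the ODE `u''' = f`, with `f` smooth and `I₃ ≠ 0` on an open set
`D`, is equivalent to `ū''' = ā(x̄)³·ū` (with `ā` smooth and nowhere vanishing) under a
contact transformation `(φ, ψ, χ)` with contact multiplier `lam`, then, setting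
`H := (ā'/ā²)∘φ`, `b := ā∘φ`, `a₁ := lam`, `η := D̂ₓχ/D̂ₓφ` and `f̄ := (ā∘φ)³·ψ`,
the systems (i)–(v) of Proposition 4.2 hold. -/
theorem construction_fourDim_contact
    (D : Set (ℝ × ℝ × ℝ × ℝ)) (hDopen : IsOpen D)
    (f : Fn)
    (hf : ContDiffOn ℝ (⊤ : ℕ∞)
      (fun z : ℝ × ℝ × ℝ × ℝ => f z.1 z.2.1 z.2.2.1 z.2.2.2) D)
    (hI3 : ∀ x u p q, (x, u, p, q) ∈ D → I3 f x u p q ≠ 0)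
    (abar : ℝ → ℝ) (habar : ContDiff ℝ (⊤ : ℕ∞) abar) (habar0 : ∀ t, abar t ≠ 0)
    (U : Set (ℝ × ℝ × ℝ)) (φ ψ χ lam : Fn3)
    (hct : IsContactTransformOn U φ ψ χ lam)
    (heqv : ContactEquivOn f (fun xb ub _ _ => (abar xb)^3 * ub) U φ ψ χ)
    (H : Fn3) (hH : H = fun x u p => deriv abar (φ x u p) / (abar (φ x u p))^2)
    (b : Fn3) (hb : b = fun x u p => abar (φ x u p))
    (a1 : Fn3) (ha1 : a1 = lam)
    (η : Fn)
    (hη : η = fun x u p q => Dhat f (lift χ) x u p q / Dhat f (lift φ) x u p q)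
    (fbar : Fn3) (hfbar : fbar = fun x u p => (abar (φ x u p))^3 * ψ x u p) :
    ∀ x u p q, (x, u, p, q) ∈ D → (x, u, p) ∈ U →
      -- (i)  the Riccati equation for H
      (-(2 / J3 f x u p q) * Dhat f (lift H) x u p q + (H x u p)^2 = Kinv f x u p q) ∧
      -- (ii)  the equation for b
      (Dhat f (lift b) x u p q = -(J3 f x u p q * H x u p) * b x u p) ∧
      -- (iii)  the system for a₁
      (Dhat f (lift a1) x u p q
         = J3 f x u p q * (H x u p + I5 f x u p q) * a1 x u p ∧
       pdu3 a1 x u p = (H x u p * I7 f x u p q - Qinv f x u p q) * a1 x u p ∧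
       pdp3 a1 x u p
         = (I4 f x u p q * (H x u p + I5 f x u p q)
             - I7 f x u p q / J3 f x u p q) * a1 x u p ∧
       pdq (lift a1) x u p q = 0) ∧
      -- (iv)  the system for φ
      (Dhat f (lift φ) x u p q = -(J3 f x u p q) / b x u p ∧
       pdu3 φ x u p = -(I7 f x u p q) / b x u p ∧
       pdp3 φ x u p = -(I4 f x u p q) / b x u p) ∧
      -- (v)  the system for η, χ, ψ
      (Dhat f η x u p q = -(J3 f x u p q / b x u p) * fbar x u p ∧
       pdu η x u p q
         = ((H x u p + I5 f x u p q)^2 / 2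
              + I2 f x u p q / (2 * (J3 f x u p q)^2)) * (b x u p)^2 * a1 x u p
             - (I7 f x u p q / b x u p) * fbar x u p ∧
       pdp η x u p q
         = ((H x u p + I5 f x u p q) / J3 f x u p q
              + I1 f x u p q / (3 * (J3 f x u p q)^2)) * (b x u p)^2 * a1 x u p
             - (I4 f x u p q / b x u p) * fbar x u p ∧
       pdq η x u p q = (b x u p)^2 * a1 x u p / (J3 f x u p q)^2 ∧
       Dhat f (lift χ) x u p q = -(J3 f x u p q / b x u p) * η x u p q ∧
       pdu3 χ x u p
         = -(H x u p + I5 f x u p q) * b x u p * a1 x u p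
             - (I7 f x u p q / b x u p) * η x u p q ∧
       pdp3 χ x u p
         = -(b x u p * a1 x u p / J3 f x u p q)
             - (I4 f x u p q / b x u p) * η x u p q ∧
       I7 f x u p q * Dhat f (lift ψ) x u p q
         = J3 f x u p q * (pdu3 ψ x u p - a1 x u p) ∧
       pdx3 ψ x u p = χ x u p * pdx3 φ x u p - p * a1 x u p ∧
       pdp3 ψ x u p = -(I4 f x u p q / b x u p) * χ x u p) := by
  set W : Set (ℝ × ℝ × ℝ × ℝ) := D ∩ (fun z => (z.1, z.2.1, z.2.2.1)) ⁻¹' U with hWdef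
  have hproj : ContDiff ℝ ∞ fun z : ℝ × ℝ × ℝ × ℝ => (z.1, z.2.1, z.2.2.1) :=
    contDiff_fst.prodMk (contDiff_snd.fst.prodMk contDiff_snd.snd.fst)
  have hW : IsOpen W := hDopen.inter (hct.isOpen.preimage hproj.continuous)
  have hfW : SmoothFnOn W f := hf.mono fun z hz => hz.1
  have hsm := hct.smooth.comp hproj.contDiffOn fun z (hz : z ∈ W) => hz.2
  have hφ : SmoothFnOn W (lift φ) := hsm.fst
  have hψ : SmoothFnOn W (lift ψ) := hsm.snd.fst
  have hχ : SmoothFnOn W (lift χ) := hsm.snd.snd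
  have hlam : SmoothFnOn W (lift lam) :=
    ((hψ.pdu hW).sub (hχ.mul (hφ.pdu hW))).congr fun x u p q hz =>
      (hct.contact_u x u p hz.2).symm
  have hp : ∀ x u p q, (x, u, p, q) ∈ W → pdp3 ψ x u p = χ x u p * pdp3 φ x u p :=
    fun x u p q hz => sub_eq_zero.1 (hct.contact_p x u p hz.2)
  have hu : ∀ x u p q, (x, u, p, q) ∈ W →
      pdu3 ψ x u p = χ x u p * pdu3 φ x u p + lam x u p :=
    fun x u p q hz => by linear_combination hct.contact_u x u p hz.2
  have hx : ∀ x u p q, (x, u, p, q) ∈ W →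
      pdx3 ψ x u p = χ x u p * pdx3 φ x u p - p * lam x u p :=
    fun x u p q hz => by linear_combination hct.contact_x x u p hz.2
  have hlam0 : ∀ x u p q, (x, u, p, q) ∈ W → lam x u p ≠ 0 :=
    fun x u p q hz => hct.lam_ne x u p hz.2
  have hss := hfW.dhat hW hφ
  set W' : Set (ℝ × ℝ × ℝ × ℝ) :=
    W ∩ (fun z => Dhat f (lift φ) z.1 z.2.1 z.2.2.1 z.2.2.2) ⁻¹' {0}ᶜ with hW'def
  have hW' : IsOpen W' :=
    hss.continuousOn.isOpen_inter_preimage hW isOpen_compl_singleton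
  have hsub : W' ⊆ W := Set.inter_subset_left
  have hs : ∀ x u p q, (x, u, p, q) ∈ W' → Dhat f (lift φ) x u p q ≠ 0 :=
    fun x u p q hz => hz.2
  have key := fun x u p q (hz : (x, u, p, q) ∈ W') =>
    contact_system_of_ne_zero hW' (hfW.mono hsub) (hφ.mono hsub) (hψ.mono hsub)
      (hχ.mono hsub) (hlam.mono hsub) habar habar0 (fun x u p q hz => hp x u p q hz.1)
      (fun x u p q hz => hu x u p q hz.1) (fun x u p q hz => hx x u p q hz.1)
      (fun x u p q hz => hlam0 x u p q hz.1) hs hη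
      (fun x u p q hz => heqv.dhat_eq hW' (hfW.mono hsub) (hφ.mono hsub) (hχ.mono hsub)
        (fun x u p q hz => hz.1.2) hs hη hz) hH hz
  intro x u p q hD hU
  have hzW : (x, u, p, q) ∈ W := ⟨hD, hU⟩
  have hz : (x, u, p, q) ∈ W' := by
    refine ⟨hzW, fun h0 => ?_⟩
    by_cases hev : ∀ᶠ z in nhds (x, u, p, q), z ∉ W'
    · obtain ⟨N, hN, hNo, hzN⟩ := eventually_nhds_iff.1 hev
      have hNW : N ∩ W ⊆ W := Set.inter_subset_right
      exact notMem_of_dhat_eq_zero (hNo.inter hW) (hfW.mono hNW) (hφ.mono hNW)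
        (hψ.mono hNW) (hχ.mono hNW) (hlam.mono hNW) (fun x u p q hz => hp x u p q hz.2)
        (fun x u p q hz => hu x u p q hz.2) (fun x u p q hz => hx x u p q hz.2)
        (fun x u p q hz => hlam0 x u p q hz.2)
        (fun x u p q hz => by_contra fun h => hN _ hz.1 ⟨hz.2, h⟩) ⟨hzN, hzW⟩
    · have hE : SmoothFnOn W fun x u p q =>
          (abar (φ x u p) * Dhat f (lift φ) x u p q) ^ 3 + I3 f x u p q :=
        (((hφ.comp_left habar).mul hss).pow 3).add (hfW.i3 hW)
      have hne := (hE.continuousOn.continuousAt (hW.mem_nhds hzW)).eventually_ne (y := 0)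
        (by
          have h0' : Dhat f (lift φ) x u p q = 0 := h0
          simpa [h0'] using hI3 x u p q hD)
      obtain ⟨z, hz, hz'⟩ := ((Filter.not_eventually.1 hev).and_eventually hne).exists
      exact hz' (by
        simp only [(key z.1 z.2.1 z.2.2.1 z.2.2.2 (not_not.1 hz)).1, neg_add_cancel])
  have hs0 := hs x u p q hz
  obtain ⟨-, hJ, h4, h7, hbt, hlt, hlu, hlp, hK, hηq, hηp, hηu, hχp, hχu⟩ := key x u p q hz
  have hηt := heqv.dhat_eq hW' (hfW.mono hsub) (hφ.mono hsub) (hχ.mono hsub)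
    (fun x u p q hz => hz.1.2) hs hη hz
  have hχt : Dhat f (lift χ) x u p q = η x u p q * Dhat f (lift φ) x u p q := by
    rw [hη]
    exact (div_mul_cancel₀ _ hs0).symm
  have hψt : Dhat f (lift ψ) x u p q = χ x u p * Dhat f (lift φ) x u p q := by
    have e (g : Fn3) : Dhat f (lift g) x u p q
        = pdx3 g x u p + p * pdu3 g x u p + q * pdp3 g x u p :=
      (congrArg (_ + f x u p q * ·) (pdq_lift g x u p q)).trans (by rw [mul_zero, add_zero]; rfl)
    rw [e, e]
    linear_combination hx x u p q hzW + p * hu x u p q hzW + q * hp x u p q hzW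
  have hψp := hp x u p q hzW
  have hψu := hu x u p q hzW
  have hψx := hx x u p q hzW
  have hb0 := habar0 (φ x u p)
  subst hb ha1 hfbar
  have e4 : pdp3 φ x u p = -I4 f x u p q / abar (φ x u p) := by
    rw [eq_div_iff hb0]; linear_combination h4
  have e7 : pdu3 φ x u p = -I7 f x u p q / abar (φ x u p) := by
    rw [eq_div_iff hb0]; linear_combination h7
  have es : Dhat f (lift φ) x u p q = -J3 f x u p q / abar (φ x u p) := by
    rw [eq_div_iff hb0]; linear_combination hJ
  have hJ0 : J3 f x u p q ≠ 0 := hJ ▸ neg_ne_zero.2 (mul_ne_zero hb0 hs0)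
  have eηq : pdq η x u p q = abar (φ x u p) ^ 2 * a1 x u p / J3 f x u p q ^ 2 := by
    rw [es] at hηq
    field_simp at hηq ⊢
    linear_combination hηq
  rw [eηq, e4] at hηp
  rw [eηq, e7] at hηu
  rw [eηq, e4, es] at hχp
  rw [eηq, e7, es] at hχu
  rw [es, e4, e7] at hlp
  rw [es] at hbt hηt hχt hψt
  rw [e7] at hψu
  refine ⟨?_, ?_, ⟨hlt, hlu, ?_, pdq_lift ..⟩, ⟨es, e7, e4⟩, ?_, ?_, ?_, eηq,
    ?_, ?_, ?_, ?_, hψx, ?_⟩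
  · rw [Kinv, I9]
    field_simp
    linear_combination hK
  · rw [hbt]
    field_simp
  · field_simp at hlp ⊢
    linear_combination -hlp
  · rw [hηt]
    ring
  · field_simp at hηu ⊢
    linear_combination hηu
  · field_simp at hηp ⊢
    linear_combination hηp
  · rw [hχt]
    ring
  · field_simp at hχu ⊢
    linear_combination hχu
  · field_simp at hχp ⊢
    linear_combination hχp
  · rw [hψt, hψu]
    ring
  · rw [hψp, e4]
    ring

end
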